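/- arXiv:math/0004189 — 2 statements merged into one kernel-verified Lean document; each statement's English description precedes it below -/
import Mathlib

section
/- Let p and q be twin primes with q - p = 2, suppose p ≡ 3 (mod 8), and suppose there exist integers a, b, c and signs ε, δ ∈ {+1, -1} such that q = a² + b² and (a + ε)² + (b + δ)² = c². Let σ ∈ {+1, -1} and let E_σ be the elliptic curve y² = x(x + σp)(x + σq). Then the Mordell–Weil group E_σ(K) over the Gauss field K = ℚ(√-1) is isomorphic as an abelian group to (ℤ/2ℤ) ⊕ (ℤ/2ℤ) ⊕ ℤ; in particular rank E_σ(K) = 1. -/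
/-- The Gauss field `K = ℚ(√-1)`, realized as the subfield of `ℂ` generated by `i`. -/
noncomputable def GaussField : IntermediateField ℚ ℂ :=
  IntermediateField.adjoin ℚ {Complex.I}

/-- The elliptic curve `E_σ : y² = x (x + σp) (x + σq)` as a Weierstrass curve over `ℚ`. -/
def twinCurve (p q σ : ℤ) : WeierstrassCurve ℚ :=
  ⟨0, (σ : ℚ) * ((p : ℚ) + (q : ℚ)), 0, ((σ : ℚ) * (p : ℚ)) * ((σ : ℚ) * (q : ℚ)), 0⟩

namespace GaussianInt

open Zsqrtd

theorem isUnit_sqrtd : IsUnit (sqrtd : GaussianInt) := by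
  rw [← norm_eq_one_iff' (by norm_num)]; simp [norm_def]

theorem isUnit_cases {u : GaussianInt} (hu : IsUnit u) :
    ∃ v : GaussianInt, IsUnit v ∧ (u = v ^ 2 ∨ u = sqrtd * v ^ 2) := by
  have h : u.re * u.re + u.im * u.im = 1 := by
    have := (norm_eq_one_iff' (d := -1) (by norm_num) u).2 hu
    rw [norm_def] at this
    linarith
  have hre : u.re ≤ 1 := by nlinarith [mul_self_nonneg u.im]
  have hre' : -1 ≤ u.re := by nlinarith [mul_self_nonneg u.im]
  have him : u.im ≤ 1 := by nlinarith [mul_self_nonneg u.re]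
  have him' : -1 ≤ u.im := by nlinarith [mul_self_nonneg u.re]
  obtain ⟨a, b⟩ := u
  simp only at h hre hre' him him'
  interval_cases a <;> interval_cases b <;> norm_num at h
  · exact ⟨sqrtd, isUnit_sqrtd, .inl (by ext <;> simp [pow_two])⟩
  · exact ⟨sqrtd, isUnit_sqrtd, .inr (by ext <;> simp [pow_two])⟩
  · exact ⟨1, isUnit_one, .inr (by ext <;> simp)⟩
  · exact ⟨1, isUnit_one, .inl (by ext <;> simp)⟩

theorem sqrtd_sq : (sqrtd : GaussianInt) ^ 2 = -1 := by
  ext <;> simp [pow_two]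

/-- A Gaussian integer whose norm is a rational prime is a prime element. -/
theorem prime_of_prime_norm {z : GaussianInt} (h : Prime z.norm) : Prime z := by
  rw [← irreducible_iff_prime]
  refine ⟨fun hz => ?_, fun a b hab => ?_⟩
  · rw [(norm_eq_one_iff' (by norm_num) z).2 hz] at h
    exact not_prime_one h
  · rw [← norm_eq_one_iff' (by norm_num) a, ← norm_eq_one_iff' (by norm_num) b]
    rw [hab, Zsqrtd.norm_mul] at h
    have ha := norm_nonneg a
    have hb := norm_nonneg b
    rcases h.irreducible.isUnit_or_isUnit rfl with h | h <;>
      rcases Int.isUnit_iff.1 h with h | h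
    · exact .inl h
    · omega
    · exact .inr h
    · omega

/-- The prime `1 + i` above `2`. -/
def oneAddI : GaussianInt := ⟨1, 1⟩

theorem prime_oneAddI : Prime oneAddI :=
  prime_of_prime_norm (by norm_num [norm_def, oneAddI, Int.prime_two])

theorem oneAddI_sq : oneAddI ^ 2 = 2 * sqrtd := by
  ext <;> simp [pow_two, oneAddI]

theorem oneAddI_dvd_iff {z : GaussianInt} : oneAddI ∣ z ↔ Even (z.re + z.im) := by
  constructor
  · rintro ⟨w, rfl⟩
    exact ⟨w.re, by simp [oneAddI]⟩
  · rintro ⟨k, hk⟩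
    refine ⟨⟨k, k - z.re⟩, ?_⟩
    ext
    · simp [oneAddI]
    · simp [oneAddI]; linarith

theorem prime_intCast {p : ℤ} (hp : Prime p) (hp0 : 0 < p) (hmod : p % 4 = 3) :
    Prime (p : GaussianInt) := by
  lift p to ℕ using hp0.le
  have : Fact p.Prime := ⟨Nat.prime_iff_prime_int.2 hp⟩
  exact_mod_cast prime_of_nat_prime_of_mod_four_eq_three p (by omega)

/-- The rational prime `p ≡ 3 mod 4` divides both terms of a sum of two squares it divides. -/
theorem intCast_dvd_of_dvd_norm {p : ℤ} (hp : Prime p) (hp0 : 0 < p) (hmod : p % 4 = 3)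
    {z : GaussianInt} (h : p ∣ z.norm) : (p : GaussianInt) ∣ z := by
  have hP : Prime (p : GaussianInt) := prime_intCast hp hp0 hmod
  have h1 : (p : GaussianInt) ∣ z * star z := by
    rw [← norm_eq_mul_conj]
    exact (intCast_dvd_intCast _ _).2 h
  rcases hP.dvd_or_dvd h1 with h2 | h2
  · exact h2
  · rw [intCast_dvd] at h2 ⊢
    simpa using h2

theorem dvd_and_dvd_of_dvd_sq_sub_two_mul_sq {p : ℤ} (hp : Prime p) (hp0 : 0 < p)
    (hmod : p % 8 = 3) {x y : ℤ} (h : p ∣ x ^ 2 - 2 * y ^ 2) : p ∣ x ∧ p ∣ y := by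
  lift p to ℕ using hp0.le
  have : Fact p.Prime := ⟨Nat.prime_iff_prime_int.2 hp⟩
  have h2 : ¬ IsSquare (2 : ZMod p) := by
    rw [ZMod.exists_sq_eq_two_iff (by omega)]
    omega
  have h' : (x : ZMod p) ^ 2 = 2 * (y : ZMod p) ^ 2 := by
    have := (ZMod.intCast_zmod_eq_zero_iff_dvd _ p).2 h
    push_cast at this
    linear_combination this
  have hy : (y : ZMod p) = 0 := by
    by_contra hy
    exact h2 ⟨x / y, by field_simp; rw [h']⟩
  have hx : (x : ZMod p) = 0 := by simpa [hy] using h'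
  exact ⟨(ZMod.intCast_zmod_eq_zero_iff_dvd _ p).1 hx, (ZMod.intCast_zmod_eq_zero_iff_dvd _ p).1 hy⟩

theorem dvd_of_dvd_fourth_pow_add_fourth_pow {q : ℤ} (hq : Prime q) (hq0 : 0 < q)
    (hmod : q % 8 = 5) {x y : ℤ} (h : q ∣ x ^ 4 + y ^ 4) : q ∣ y := by
  lift q to ℕ using hq0.le
  have : Fact q.Prime := ⟨Nat.prime_iff_prime_int.2 hq⟩
  have h' : (x : ZMod q) ^ 4 + (y : ZMod q) ^ 4 = 0 := by
    have := (ZMod.intCast_zmod_eq_zero_iff_dvd _ q).2 h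
    exact_mod_cast this
  rw [← ZMod.intCast_zmod_eq_zero_iff_dvd]
  by_contra hy
  have h4 : ((x : ZMod q) / y) ^ 4 = -1 := by
    field_simp
    linear_combination h'
  have hne : ((x : ZMod q) / y) ≠ 0 := by
    intro h0
    rw [h0] at h4
    norm_num at h4
  have : Fact (2 < q) := ⟨by omega⟩
  have hord : orderOf ((x : ZMod q) / y) = 2 ^ (2 + 1) := by
    apply orderOf_eq_prime_pow
    · rw [show 2 ^ 2 = 4 by norm_num, h4]
      exact ZMod.neg_one_ne_one
    · rw [show 2 ^ (2 + 1) = 4 * 2 by norm_num, pow_mul, h4]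
      norm_num
  have := ZMod.orderOf_dvd_card_sub_one hne
  rw [hord] at this
  omega

section Split

variable {q : ℤ} {π : GaussianInt}

theorem dvd_of_dvd_intCast (hq : Prime q) (hπ : π.norm = q) {n : ℤ}
    (h : π ∣ (n : GaussianInt)) : q ∣ n := by
  obtain ⟨w, hw⟩ := h
  have := congrArg Zsqrtd.norm hw
  rw [Zsqrtd.norm_mul, hπ, Zsqrtd.norm_intCast] at this
  exact or_self_iff.1 (hq.dvd_or_dvd ⟨_, this⟩)

theorem not_dvd_im (hq : Prime q) (hπ : π.norm = q) : ¬ q ∣ π.im := by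
  have hn : π.re ^ 2 + π.im ^ 2 = q := by rw [← hπ, norm_def]; ring
  intro hb
  have ha : q ∣ π.re ^ 2 := (dvd_add_left (hb.pow two_ne_zero)).1 (hn ▸ dvd_refl q)
  obtain ⟨c, hc⟩ := hq.dvd_of_dvd_pow ha
  obtain ⟨d, hd⟩ := hb
  rw [hc, hd] at hn
  have h1 : q * (c ^ 2 + d ^ 2) = 1 := by
    apply mul_left_cancel₀ hq.ne_zero
    linear_combination hn
  exact hq.not_isUnit (IsUnit.of_mul_eq_one _ h1)

theorem not_dvd_star (hq : Prime q) (hq2 : ¬ q ∣ 2) (hπ : π.norm = q) : ¬ π ∣ star π := by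
  intro h
  have h1 : π ∣ ((2 * π.im : ℤ) : GaussianInt) := by
    have : ((2 * π.im : ℤ) : GaussianInt) = sqrtd * (star π - π) := by
      ext <;> simp
      ring
    rw [this]
    exact (dvd_sub h dvd_rfl).mul_left _
  exact (hq.dvd_or_dvd (dvd_of_dvd_intCast hq hπ h1)).elim hq2 (not_dvd_im hq hπ)

theorem exists_dvd_sqrtd_sub_intCast (hq : Prime q) (hπ : π.norm = q) :
    ∃ j : ℤ, π ∣ sqrtd - (j : GaussianInt) := by
  have hn : π.re ^ 2 + π.im ^ 2 = q := by rw [← hπ, norm_def]; ring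
  have hb := not_dvd_im hq hπ
  obtain ⟨s, t, hst⟩ := (hq.coprime_iff_not_dvd).2 hb
  refine ⟨-π.re * t, ?_⟩
  have hqπ : π ∣ (q : GaussianInt) := ⟨star π, by rw [← norm_eq_mul_conj, hπ]⟩
  have h1 : sqrtd - ((-π.re * t : ℤ) : GaussianInt)
      = (t : GaussianInt) * π + sqrtd * (s : GaussianInt) * (q : GaussianInt) := by
    ext
    · simp; ring
    · simp; linear_combination -hst
  rw [h1]
  exact dvd_add (dvd_mul_left _ _) (hqπ.mul_left _)

/-- `i` is not a square modulo a prime of norm `q ≡ 5 mod 8`. -/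
theorem dvd_of_dvd_sq_sub_sqrtd_mul_sq (hq : Prime q) (hmod : q % 8 = 5) (hπ : π.norm = q)
    {x y : GaussianInt} (h : π ∣ x ^ 2 - sqrtd * y ^ 2) : π ∣ x ∧ π ∣ y := by
  have hP : Prime π := prime_of_prime_norm (hπ ▸ hq)
  have hq0 : 0 < q := lt_of_le_of_ne (hπ ▸ norm_nonneg π) hq.ne_zero.symm
  have hqπ : π ∣ (q : GaussianInt) := ⟨star π, by rw [← norm_eq_mul_conj, hπ]⟩
  obtain ⟨j, hj⟩ := exists_dvd_sqrtd_sub_intCast hq hπ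
  have key (z : GaussianInt) : π ∣ z - ((z.re + z.im * j : ℤ) : GaussianInt) := by
    have : z - ((z.re + z.im * j : ℤ) : GaussianInt) =
        (z.im : GaussianInt) * (sqrtd - (j : GaussianInt)) := by
      ext <;> simp
    rw [this]
    exact hj.mul_left _
  set X : ℤ := x.re + x.im * j with hX
  set Y : ℤ := y.re + y.im * j with hY
  have h4 : π ∣ ((X ^ 4 + Y ^ 4 : ℤ) : GaussianInt) := by
    have e : ((X ^ 4 + Y ^ 4 : ℤ) : GaussianInt)
        = (x ^ 2 - sqrtd * y ^ 2) * (x ^ 2 + sqrtd * y ^ 2)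
          - (x - (X : GaussianInt)) * ((x + (X : GaussianInt)) * (x ^ 2 + (X : GaussianInt) ^ 2))
          - (y - (Y : GaussianInt)) * ((y + (Y : GaussianInt)) * (y ^ 2 + (Y : GaussianInt) ^ 2)) := by
      push_cast
      linear_combination y ^ 4 * sqrtd_sq
    rw [e]
    exact dvd_sub (dvd_sub (h.mul_right _) ((key x).mul_right _)) ((key y).mul_right _)
  have hy : π ∣ y := by
    have h5 := dvd_of_dvd_fourth_pow_add_fourth_pow hq hq0 hmod (dvd_of_dvd_intCast hq hπ h4)
    have h6 : π ∣ (Y : GaussianInt) := hqπ.trans ((intCast_dvd_intCast _ _).2 h5)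
    exact (dvd_sub_left h6).1 (key y)
  refine ⟨hP.dvd_of_dvd_pow (n := 2) ?_, hy⟩
  exact (dvd_sub_left ((hy.pow two_ne_zero).mul_left _)).1 h

end Split

end GaussianInt

/-- Two elements of a Bezout domain whose product is a square are, up to units and squares,
equal to a common divisor. -/
theorem exists_dvd_and_eq_mul_sq {R : Type*} [CommRing R] [IsDomain R] [IsBezout R]
    {m n y : R} (hm : m ≠ 0) (h : m * n = y ^ 2) :
    ∃ g u k : R, g ∣ m ∧ g ∣ n ∧ IsUnit u ∧ m = u * g * k ^ 2 := by
  classical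
  let := IsBezout.toGCDDomain R
  obtain ⟨m', n', hm', hn', hu⟩ := extract_gcd m n
  have hg : gcd m n ≠ 0 := fun h0 => hm ((gcd_eq_zero_iff m n).1 h0).1
  have hy : gcd m n ∣ y := by
    rw [← IsIntegrallyClosed.pow_dvd_pow_iff (n := 2) two_ne_zero, ← h]
    nth_rewrite 2 [hm']
    nth_rewrite 3 [hn']
    exact ⟨m' * n', by ring⟩
  obtain ⟨y', hy'⟩ := hy
  have h' : m' * n' = y' ^ 2 := by
    apply mul_left_cancel₀ (pow_ne_zero 2 hg)
    calc gcd m n ^ 2 * (m' * n') = (gcd m n * m') * (gcd m n * n') := by ring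
      _ = gcd m n ^ 2 * y' ^ 2 := by rw [← hm', ← hn', h, ← mul_pow, ← hy']
  obtain ⟨d, v, hd⟩ := exists_associated_pow_of_mul_eq_pow hu h'
  exact ⟨gcd m n, v, d, gcd_dvd_left m n, gcd_dvd_right m n, v.isUnit,
    by rw [mul_assoc, mul_left_comm, mul_comm (v : R), hd, ← hm']⟩

/-- The numerical data attached to a twin prime pair: `α = σp`, `β = σq`, and a Gaussian prime
`π` above `q`. -/
structure TwinParams (p q σ α β : ℤ) (π : GaussianInt) : Prop where
  prime_p : Prime p
  prime_q : Prime q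
  q_eq : q = p + 2
  p_mod : p % 8 = 3
  p_pos : 0 < p
  sign : σ = 1 ∨ σ = -1
  α_eq : α = σ * p
  β_eq : β = σ * q
  norm_π : π.norm = q

namespace GaussianInt

open Zsqrtd

theorem re_sq (z : GaussianInt) : (z ^ 2).re = z.re ^ 2 - z.im ^ 2 := by
  simp [pow_two]; ring

theorem even_im_sq (z : GaussianInt) : Even (z ^ 2).im :=
  ⟨z.re * z.im, by simp [pow_two]; ring⟩

theorem oneAddI_dvd_of_even_re_sq {z : GaussianInt} (h : Even (z ^ 2).re) : oneAddI ∣ z := by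
  rw [oneAddI_dvd_iff]
  rw [re_sq] at h
  simpa [Int.even_add, Int.even_sub, Int.even_pow] using h

theorem re_sq_emod_four_ne_two (z : GaussianInt) : (z ^ 2).re % 4 ≠ 2 := by
  rw [re_sq]
  rcases Int.even_or_odd' z.re with ⟨a, ha | ha⟩ <;>
    rcases Int.even_or_odd' z.im with ⟨b, hb | hb⟩ <;> rw [ha, hb] <;> ring_nf <;> omega

end GaussianInt

theorem sq_ne_mul_sq_of_prime {R : Type*} [CommRing R] [IsDomain R] {ϖ γ r e : R}
    (hϖ : Prime ϖ) (hγ : ¬ ϖ ∣ γ) (hre : IsCoprime r e) : r ^ 2 ≠ ϖ * γ * e ^ 2 := by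
  intro h
  obtain ⟨k, hk⟩ : ϖ ∣ r := hϖ.dvd_of_dvd_pow (n := 2) (h ▸ ⟨γ * e ^ 2, by ring⟩)
  have h1 : ϖ ∣ γ * e ^ 2 := by
    refine ⟨k ^ 2, mul_left_cancel₀ hϖ.ne_zero ?_⟩
    rw [hk] at h
    linear_combination -h
  have h2 : ϖ ∣ e := hϖ.dvd_of_dvd_pow ((hϖ.dvd_or_dvd h1).resolve_left hγ)
  exact hϖ.not_isUnit (hre.isUnit_of_dvd' ⟨k, hk⟩ h2)

namespace TwinParams

open GaussianInt Zsqrtd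

variable {p q σ α β : ℤ} {π : GaussianInt}

section

variable (h : TwinParams p q σ α β π)
include h

theorem prime_p_gaussian : Prime (p : GaussianInt) :=
  prime_intCast h.prime_p h.p_pos (by have := h.p_mod; omega)

theorem prime_π : Prime π := prime_of_prime_norm (h.norm_π ▸ h.prime_q)

theorem star_params : TwinParams p q σ α β (star π) :=
  { h with norm_π := by rw [Zsqrtd.norm_conj, h.norm_π] }

theorem mul_star : π * star π = q := by rw [← norm_eq_mul_conj, h.norm_π]

theorem isUnit_sign : IsUnit (σ : GaussianInt) := by
  rcases h.sign with h | h <;> simp [h]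

theorem not_dvd_star : ¬ π ∣ star π := by
  refine GaussianInt.not_dvd_star h.prime_q (fun h2 => ?_) h.norm_π
  have := Int.le_of_dvd (by norm_num) h2
  have := h.q_eq
  have := h.p_mod
  have := h.p_pos
  omega

theorem odd_α : Odd α := by
  have h1 : Odd p := by rw [Int.odd_iff]; have := h.p_mod; omega
  rcases h.sign with hs | hs <;> simp [h.α_eq, hs, h1]

theorem sub_eq : β - α = 2 * σ := by
  rw [h.α_eq, h.β_eq, h.q_eq]; ring

theorem odd_β : Odd β := by
  have : β = α + 2 * σ := by linarith [h.sub_eq]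
  rw [this]
  exact h.odd_α.add_even (even_two_mul _)

theorem β_eq_mul : (β : GaussianInt) = π * (σ * star π) := by
  rw [mul_left_comm, h.mul_star, h.β_eq]; push_cast; rfl

theorem not_dvd_sign_mul_star : ¬ π ∣ σ * star π := by
  rw [h.isUnit_sign.dvd_mul_left]
  exact h.not_dvd_star

theorem α_ne_zero : α ≠ 0 := by
  intro h0; simpa [h0] using h.odd_α

theorem β_ne_zero : β ≠ 0 := by
  intro h0; simpa [h0] using h.odd_β

theorem sub_ne_zero : β - α ≠ 0 := by
  rw [h.sub_eq]; rcases h.sign with hs | hs <;> simp [hs]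

theorem not_oneAddI_dvd_α : ¬ oneAddI ∣ (α : GaussianInt) := by
  rw [oneAddI_dvd_iff]; simpa using h.odd_α

theorem not_oneAddI_dvd_β : ¬ oneAddI ∣ (β : GaussianInt) := by
  rw [oneAddI_dvd_iff]; simpa using h.odd_β

theorem sq_ne_α_mul_sq {r e w : GaussianInt} (hw : IsUnit w) (hre : IsCoprime r e) :
    r ^ 2 ≠ w * α * e ^ 2 := by
  have := sq_ne_mul_sq_of_prime (γ := w * σ) h.prime_p_gaussian
    (fun h0 => h.prime_p_gaussian.not_isUnit (isUnit_of_dvd_unit h0 (hw.mul h.isUnit_sign))) hre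
  convert this using 2
  rw [h.α_eq]; push_cast; ring

theorem sq_ne_β_mul_sq {r e w : GaussianInt} (hw : IsUnit w) (hre : IsCoprime r e) :
    r ^ 2 ≠ w * β * e ^ 2 := by
  have := sq_ne_mul_sq_of_prime (γ := w * (σ * star π)) h.prime_π
    (fun h0 => h.not_dvd_sign_mul_star ((hw.dvd_mul_left).1 h0)) hre
  convert this using 2
  rw [h.β_eq_mul]; ring

/-- A point whose `x`-coordinate and its two shifts are squares has numerator and denominator of
opposite parity at `1 + i`. -/
theorem oneAddI_dvd_or_dvd_of_sq {r e s t : GaussianInt} (hs : r ^ 2 + α * e ^ 2 = s ^ 2)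
    (ht : r ^ 2 + β * e ^ 2 = t ^ 2) : oneAddI ∣ r ∨ oneAddI ∣ e := by
  by_contra! hc
  have hr : ¬ Even (r ^ 2).re := fun h0 => hc.1 (oneAddI_dvd_of_even_re_sq h0)
  have he : ¬ Even (e ^ 2).re := fun h0 => hc.2 (oneAddI_dvd_of_even_re_sq h0)
  have h1 := re_sq_emod_four_ne_two s
  have h2 := re_sq_emod_four_ne_two t
  rw [← hs] at h1
  rw [← ht] at h2
  simp only [Zsqrtd.re_add, Zsqrtd.re_mul, Zsqrtd.re_intCast, Zsqrtd.im_intCast, mul_zero,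
    zero_mul, add_zero] at h1 h2
  have hα : Odd (α * (e ^ 2).re) := h.odd_α.mul (Int.not_even_iff_odd.1 he)
  have hβ : β * (e ^ 2).re = α * (e ^ 2).re + 2 * (σ * (e ^ 2).re) := by
    linear_combination (e ^ 2).re * h.sub_eq
  have hσ : Odd (σ * (e ^ 2).re) := by
    rcases h.sign with hs | hs <;> simpa [hs] using he
  rw [hβ] at h2
  rw [Int.not_even_iff_odd] at hr
  rw [Int.odd_iff] at hr hα hσ
  omega

/-- No solution of the descent equations has the first term a unit times a square and the second
term a unit times `1 + i` times a square. -/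
theorem add_ne_oneAddI_mul_sq {r e s u v : GaussianInt} (hre : IsCoprime r e) (hu : IsUnit u)
    (hv : IsUnit v) :
    u * r ^ 2 + (α : GaussianInt) * e ^ 2 ≠ v * oneAddI * s ^ 2 := by
  intro hs
  have hnu := (norm_eq_one_iff' (d := -1) (by norm_num) u).2 hu
  have hnv := (norm_eq_one_iff' (d := -1) (by norm_num) v).2 hv
  have hcong : (p : ℤ) ∣ (u * r ^ 2 + (α : GaussianInt) * e ^ 2).norm - (u * r ^ 2).norm := by
    have : (u * r ^ 2 + (α : GaussianInt) * e ^ 2).norm - (u * r ^ 2).norm =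
        α * (2 * ((u * r ^ 2).re * (e ^ 2).re + (u * r ^ 2).im * (e ^ 2).im)
          + α * (e ^ 2).norm) := by
      generalize u * r ^ 2 = x
      generalize e ^ 2 = y
      simp [norm_def]
      ring
    rw [this]
    exact Dvd.dvd.mul_right ⟨σ, by rw [h.α_eq]; ring⟩ _
  rw [hs] at hcong
  have h2 : p ∣ r.norm ^ 2 - 2 * s.norm ^ 2 := by
    have e1 : (v * oneAddI * s ^ 2).norm = 2 * s.norm ^ 2 := by
      rw [pow_two, Zsqrtd.norm_mul, Zsqrtd.norm_mul, Zsqrtd.norm_mul, hnv]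
      simp [norm_def, oneAddI]
      ring
    have e2 : (u * r ^ 2).norm = r.norm ^ 2 := by
      rw [pow_two, Zsqrtd.norm_mul, Zsqrtd.norm_mul, hnu]
      ring
    rw [e1, e2] at hcong
    rwa [← dvd_neg, neg_sub]
  obtain ⟨hr, hs'⟩ := dvd_and_dvd_of_dvd_sq_sub_two_mul_sq h.prime_p h.p_pos h.p_mod h2
  have hp4 : p % 4 = 3 := by have := h.p_mod; omega
  obtain ⟨r', hr'⟩ := intCast_dvd_of_dvd_norm h.prime_p h.p_pos hp4 hr
  obtain ⟨s', hs''⟩ := intCast_dvd_of_dvd_norm h.prime_p h.p_pos hp4 hs'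
  have hP := h.prime_p_gaussian
  have h3 : (p : GaussianInt) ∣ σ * e ^ 2 := by
    refine ⟨v * oneAddI * s' ^ 2 - u * r' ^ 2, mul_left_cancel₀ hP.ne_zero ?_⟩
    have e1 : (α : GaussianInt) = σ * p := by rw [h.α_eq]; push_cast; rfl
    rw [e1, hr', hs''] at hs
    linear_combination hs
  have h4 : (p : GaussianInt) ∣ e := hP.dvd_of_dvd_pow ((h.isUnit_sign.dvd_mul_left).1 h3)
  exact hP.not_isUnit (hre.isUnit_of_dvd' ⟨r', hr'⟩ h4)

theorem add_ne_sqrtd_mul_sq {r e t : GaussianInt} (hre : IsCoprime r e) :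
    r ^ 2 + (β : GaussianInt) * e ^ 2 ≠ sqrtd * t ^ 2 := by
  intro ht
  have hq8 : q % 8 = 5 := by have := h.p_mod; have := h.q_eq; omega
  have h1 : (β : GaussianInt) * e ^ 2 = -(r ^ 2 - sqrtd * t ^ 2) := by linear_combination ht
  have h2 : π ∣ (β : GaussianInt) := ⟨_, h.β_eq_mul⟩
  obtain ⟨⟨r', hr⟩, ⟨t', ht'⟩⟩ := dvd_of_dvd_sq_sub_sqrtd_mul_sq h.prime_q hq8 h.norm_π
    ((dvd_neg).1 (h1 ▸ h2.mul_right _))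
  have h3 : π ∣ σ * star π * e ^ 2 := by
    refine ⟨sqrtd * t' ^ 2 - r' ^ 2, mul_left_cancel₀ h.prime_π.ne_zero ?_⟩
    rw [h.β_eq_mul, hr, ht'] at ht
    linear_combination ht
  have h4 : π ∣ e := h.prime_π.dvd_of_dvd_pow
    ((h.prime_π.dvd_or_dvd h3).resolve_left h.not_dvd_sign_mul_star)
  exact h.prime_π.not_isUnit (hre.isUnit_of_dvd' ⟨r', hr⟩ h4)

theorem sqrtd_mul_add_ne_sq {r e t : GaussianInt} (hre : IsCoprime r e) :
    sqrtd * r ^ 2 + (β : GaussianInt) * e ^ 2 ≠ t ^ 2 := by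
  intro ht
  have hq8 : q % 8 = 5 := by have := h.p_mod; have := h.q_eq; omega
  have h1 : (β : GaussianInt) * e ^ 2 = t ^ 2 - sqrtd * r ^ 2 := by linear_combination ht
  have h2 : π ∣ (β : GaussianInt) := ⟨_, h.β_eq_mul⟩
  obtain ⟨⟨t', ht'⟩, ⟨r', hr⟩⟩ := dvd_of_dvd_sq_sub_sqrtd_mul_sq h.prime_q hq8 h.norm_π
    (h1 ▸ h2.mul_right _)
  have h3 : π ∣ σ * star π * e ^ 2 := by
    refine ⟨t' ^ 2 - sqrtd * r' ^ 2, mul_left_cancel₀ h.prime_π.ne_zero ?_⟩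
    rw [h.β_eq_mul, hr, ht'] at ht
    linear_combination ht
  have h4 : π ∣ e := h.prime_π.dvd_of_dvd_pow
    ((h.prime_π.dvd_or_dvd h3).resolve_left h.not_dvd_sign_mul_star)
  exact h.prime_π.not_isUnit (hre.isUnit_of_dvd' ⟨r', hr⟩ h4)

theorem not_sqrtd_one_sqrtd {r e s t : GaussianInt} (hre : IsCoprime r e)
    (hs : sqrtd * r ^ 2 + (α : GaussianInt) * e ^ 2 = s ^ 2)
    (ht : sqrtd * r ^ 2 + (β : GaussianInt) * e ^ 2 = sqrtd * t ^ 2) :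
    False := by
  have h1 := congrArg Zsqrtd.im hs
  have h2 := congrArg Zsqrtd.re ht
  simp only [Zsqrtd.im_add, Zsqrtd.im_mul, Zsqrtd.re_add, Zsqrtd.re_mul, Zsqrtd.re_intCast,
    Zsqrtd.im_intCast, Zsqrtd.re_sqrtd, Zsqrtd.im_sqrtd] at h1 h2
  obtain ⟨r', hr⟩ := even_im_sq r
  obtain ⟨s', hs'⟩ := even_im_sq s
  obtain ⟨t', ht'⟩ := even_im_sq t
  obtain ⟨e', he⟩ := even_im_sq e
  have hr2 : Even (r ^ 2).re := ⟨s' - α * e', by rw [he, hs'] at h1; linear_combination h1⟩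
  have he2 : Even (β * (e ^ 2).re) := ⟨r' - t', by rw [hr, ht'] at h2; linear_combination h2⟩
  have he3 : Even (e ^ 2).re :=
    (Int.even_mul.1 he2).resolve_left (Int.not_even_iff_odd.2 h.odd_β)
  exact prime_oneAddI.not_isUnit
    (hre.isUnit_of_dvd' (oneAddI_dvd_of_even_re_sq hr2) (oneAddI_dvd_of_even_re_sq he3))

end

end TwinParams

theorem Prime.exists_dvd_and_eq_or_eq_mul {R : Type*} [CommRing R] [IsDomain R] {ϖ g n : R}
    (hϖ : Prime ϖ) (h : g ∣ ϖ * n) : ∃ g', g' ∣ n ∧ (g = g' ∨ g = ϖ * g') := by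
  rcases hϖ.left_dvd_or_dvd_right_of_dvd_mul h with ⟨g', rfl⟩ | h1
  · exact ⟨g', (mul_dvd_mul_iff_left hϖ.ne_zero).1 h, .inr rfl⟩
  · exact ⟨g, h1, .inl rfl⟩

namespace TwinParams

open GaussianInt Zsqrtd

variable {p q σ α β : ℤ} {π : GaussianInt}

section

variable (h : TwinParams p q σ α β π)
include h

theorem exists_eq_unit_mul {m e Y : GaussianInt} (hm : m ≠ 0) (hme : IsCoprime m e)
    (hY : Y ^ 2 = m * ((m + α * e ^ 2) * (m + β * e ^ 2))) :
    ∃ (u k : GaussianInt) (a b c : ℕ), IsUnit u ∧ a < 2 ∧ b < 2 ∧ c < 2 ∧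
      m = u * p ^ a * π ^ b * star π ^ c * k ^ 2 := by
  obtain ⟨g, u, k, hgm, hgn, hu, hmk⟩ := exists_dvd_and_eq_mul_sq hm hY.symm
  have hge : IsCoprime g e := hme.of_isCoprime_of_dvd_left hgm
  have h1 : g ∣ (e ^ 2 * e ^ 2) * (α * β) := by
    have : (e ^ 2 * e ^ 2) * (α * β) = (m + α * e ^ 2) * (m + β * e ^ 2)
        - m * (m + (α + β) * e ^ 2) := by ring
    rw [this]
    exact dvd_sub hgn (hgm.mul_right _)
  have h2 : g ∣ (α : GaussianInt) * β :=
    (hge.pow_right.mul_right hge.pow_right).dvd_of_dvd_mul_left h1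
  have h3 : (α : GaussianInt) * β = p * (π * (star π * (σ * σ))) := by
    rw [h.β_eq_mul, h.α_eq]; push_cast; ring
  rw [h3] at h2
  obtain ⟨g₁, h2, hg⟩ := h.prime_p_gaussian.exists_dvd_and_eq_or_eq_mul h2
  obtain ⟨g₂, h2, hg₁⟩ := h.prime_π.exists_dvd_and_eq_or_eq_mul h2
  obtain ⟨g₃, h2, hg₂⟩ := h.star_params.prime_π.exists_dvd_and_eq_or_eq_mul h2
  have hg₃ : IsUnit g₃ := isUnit_of_dvd_unit h2 (h.isUnit_sign.mul h.isUnit_sign)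
  obtain ⟨a, ha, hg⟩ : ∃ a < 2, g = p ^ a * g₁ :=
    hg.elim (fun h => ⟨0, by norm_num, by simpa using h⟩) fun h => ⟨1, by norm_num, by simpa using h⟩
  obtain ⟨b, hb, hg₁⟩ : ∃ a < 2, g₁ = π ^ a * g₂ :=
    hg₁.elim (fun h => ⟨0, by norm_num, by simpa using h⟩)
      fun h => ⟨1, by norm_num, by simpa using h⟩
  obtain ⟨c, hc, hg₂⟩ : ∃ a < 2, g₂ = star π ^ a * g₃ :=
    hg₂.elim (fun h => ⟨0, by norm_num, by simpa using h⟩)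
      fun h => ⟨1, by norm_num, by simpa using h⟩
  refine ⟨u * g₃, k, a, b, c, hu.mul hg₃, ha, hb, hc, ?_⟩
  rw [hmk, hg, hg₁, hg₂]
  ring

theorem exists_sq_of_eq_sqrtd_pow_mul {m e Y r : GaussianInt} {a : ℕ} (he : IsCoprime m e)
    (hY0 : Y ≠ 0) (ha : a < 2) (hm : m = sqrtd ^ a * r ^ 2)
    (hY : Y ^ 2 = m * ((m + α * e ^ 2) * (m + β * e ^ 2))) :
    ∃ r s t : GaussianInt, m = r ^ 2 ∧ m + α * e ^ 2 = s ^ 2 ∧ m + β * e ^ 2 = t ^ 2 := by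
  have hre : IsCoprime r e := by
    rw [hm, pow_two] at he
    exact he.of_mul_left_right.of_mul_left_right
  have hr0 : r ≠ 0 := by
    rintro rfl
    rw [hm] at hY
    simp at hY
    exact hY0 hY
  have hu : IsUnit ((sqrtd : GaussianInt) ^ a) := isUnit_sqrtd.pow a
  obtain ⟨Y₁, rfl⟩ : r ∣ Y := by
    rw [← IsIntegrallyClosed.pow_dvd_pow_iff (n := 2) two_ne_zero, hY, hm]
    exact Dvd.dvd.mul_right (dvd_mul_left _ _) _
  have hY₁0 : Y₁ ≠ 0 := right_ne_zero_of_mul hY0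
  have hBC : (m + α * e ^ 2) * ((sqrtd : GaussianInt) ^ a * (m + β * e ^ 2)) = Y₁ ^ 2 := by
    apply mul_left_cancel₀ (pow_ne_zero 2 hr0)
    linear_combination -hY - ((m + α * e ^ 2) * (m + β * e ^ 2)) * hm
  have hB0 : m + α * e ^ 2 ≠ 0 := by
    intro h0
    rw [h0, zero_mul] at hBC
    exact pow_ne_zero 2 hY₁0 hBC.symm
  obtain ⟨g, u, k, hgB, hgC, hgu, hBk⟩ := exists_dvd_and_eq_mul_sq hB0 hBC
  have hBe : IsCoprime (m + α * e ^ 2) e := by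
    rw [pow_two, ← mul_assoc]
    exact he.add_mul_right_left _
  have hge : IsCoprime g e := hBe.of_isCoprime_of_dvd_left hgB
  have hg2 : g ∣ oneAddI ^ 2 := by
    rw [hu.dvd_mul_left] at hgC
    have h1 : g ∣ e ^ 2 * (2 * σ) := by
      have e1 : (β : GaussianInt) - α = 2 * σ := by exact_mod_cast congrArg (Int.cast) h.sub_eq
      have : e ^ 2 * (2 * σ) = (m + β * e ^ 2) - (m + α * e ^ 2) := by
        linear_combination (-e ^ 2) * e1
      rw [this]
      exact dvd_sub hgC hgB
    have h2 := hge.pow_right.dvd_of_dvd_mul_left h1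
    rw [h.isUnit_sign.dvd_mul_right] at h2
    rw [oneAddI_sq]
    exact h2.mul_right _
  obtain ⟨d, s, v, hd, hv, hBs⟩ : ∃ (d : ℕ) (s v : GaussianInt), d < 2 ∧ IsUnit v ∧
      m + α * e ^ 2 = v * oneAddI ^ d * s ^ 2 := by
    obtain ⟨j, hj, hgj⟩ := (dvd_prime_pow prime_oneAddI 2).1 hg2
    obtain ⟨w, hw⟩ := hgj.symm
    interval_cases j
    · exact ⟨0, k, u * w, by norm_num, hgu.mul w.isUnit, by rw [hBk, ← hw]; ring⟩
    · exact ⟨1, k, u * w, by norm_num, hgu.mul w.isUnit, by rw [hBk, ← hw]; ring⟩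
    · exact ⟨0, oneAddI * k, u * w, by norm_num, hgu.mul w.isUnit, by rw [hBk, ← hw]; ring⟩
  interval_cases d
  swap
  · rw [hm, pow_one] at hBs
    exact absurd hBs (h.add_ne_oneAddI_mul_sq hre hu hv)
  obtain ⟨b, s, hb, hBs⟩ : ∃ (b : ℕ) (s : GaussianInt), b < 2 ∧
      m + α * e ^ 2 = (sqrtd : GaussianInt) ^ b * s ^ 2 := by
    obtain ⟨w, -, hw | hw⟩ := isUnit_cases hv
    · exact ⟨0, w * s, by norm_num, by rw [hBs, hw]; ring⟩
    · exact ⟨1, w * s, by norm_num, by rw [hBs, hw]; ring⟩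
  have hs0 : s ≠ 0 := by
    rintro rfl
    exact hB0 (by rw [hBs]; ring)
  obtain ⟨Y₂, rfl⟩ : s ∣ Y₁ := by
    rw [← IsIntegrallyClosed.pow_dvd_pow_iff (n := 2) two_ne_zero, ← hBC, hBs]
    exact Dvd.dvd.mul_right (dvd_mul_left _ _) _
  have hC : (sqrtd : GaussianInt) ^ (a + b) * (m + β * e ^ 2) = Y₂ ^ 2 := by
    apply mul_left_cancel₀ (pow_ne_zero 2 hs0)
    rw [hBs] at hBC
    linear_combination hBC
  have hi := sqrtd_sq
  interval_cases a <;> interval_cases b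
  · exact ⟨r, s, Y₂, by rw [hm]; ring, by rw [hBs]; ring, by rw [← hC]; ring⟩
  · refine absurd ?_ (h.add_ne_sqrtd_mul_sq (t := sqrtd * Y₂) hre)
    rw [← one_mul (r ^ 2), ← pow_zero sqrtd, ← hm]
    linear_combination sqrtd ^ 3 * hC - (sqrtd ^ 2 - 1) * (m + β * e ^ 2) * hi
  · refine (h.not_sqrtd_one_sqrtd (s := s) (t := sqrtd * Y₂) hre ?_ ?_).elim
    · rw [← pow_one sqrtd, ← hm, hBs]; ring
    · nth_rewrite 1 [← pow_one sqrtd]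
      rw [← hm]
      linear_combination sqrtd ^ 3 * hC - (sqrtd ^ 2 - 1) * (m + β * e ^ 2) * hi
  · refine absurd ?_ (h.sqrtd_mul_add_ne_sq (t := sqrtd * Y₂) hre)
    rw [← pow_one sqrtd, ← hm]
    linear_combination sqrtd ^ 2 * hC - (sqrtd ^ 2 - 1) * (m + β * e ^ 2) * hi

/-- The main descent step: an integral point of the quartic covering whose first coordinate is a
unit times a square comes from three squares. -/
theorem exists_sq_of_eq_unit_mul {m e Y u r : GaussianInt} (he : IsCoprime m e)
    (hY0 : Y ≠ 0) (hu : IsUnit u) (hm : m = u * r ^ 2)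
    (hY : Y ^ 2 = m * ((m + α * e ^ 2) * (m + β * e ^ 2))) :
    ∃ r s t : GaussianInt, m = r ^ 2 ∧ m + α * e ^ 2 = s ^ 2 ∧ m + β * e ^ 2 = t ^ 2 := by
  obtain ⟨w, -, hw | hw⟩ := isUnit_cases hu
  · exact h.exists_sq_of_eq_sqrtd_pow_mul (a := 0) (r := w * r) he hY0 (by norm_num)
      (by rw [hm, hw]; ring) hY
  · exact h.exists_sq_of_eq_sqrtd_pow_mul (a := 1) (r := w * r) he hY0 (by norm_num)
      (by rw [hm, hw]; ring) hY

end

end TwinParams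

/-- The Weierstrass curve `y² = x (x + a) (x + b)`. -/
def WeierstrassCurve.ofRoots {F : Type*} [CommRing F] (a b : F) : WeierstrassCurve F :=
  ⟨0, a + b, 0, a * b, 0⟩

namespace WeierstrassCurve.ofRoots

open WeierstrassCurve.Affine

variable {F : Type*} [Field F] {a b : F}

theorem Δ_eq (a b : F) : (ofRoots a b).Δ = 16 * (a * b * (b - a)) ^ 2 := by
  simp [ofRoots, Δ, b₂, b₄, b₆, b₈]
  ring

theorem equation_iff {x y : F} :
    (ofRoots a b).toAffine.Equation x y ↔ y ^ 2 = x * (x + a) * (x + b) := by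
  rw [Affine.equation_iff]
  simp only [ofRoots, zero_mul, add_zero]
  ring_nf

theorem Δ_ne_zero [NeZero (2 : F)] (ha : a ≠ 0) (hb : b ≠ 0) (hab : b - a ≠ 0) :
    (ofRoots a b).Δ ≠ 0 := by
  rw [Δ_eq, show (16 : F) = 2 ^ 4 by norm_num]
  exact mul_ne_zero (pow_ne_zero _ two_ne_zero) (pow_ne_zero _ (mul_ne_zero (mul_ne_zero ha hb) hab))

theorem nonsingular_iff [NeZero (2 : F)] (ha : a ≠ 0) (hb : b ≠ 0) (hab : b - a ≠ 0) {x y : F} :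
    (ofRoots a b).toAffine.Nonsingular x y ↔ y ^ 2 = x * (x + a) * (x + b) := by
  rw [← equation_iff_nonsingular_of_Δ_ne_zero (Δ_ne_zero ha hb hab), equation_iff]

theorem negY_eq (x y : F) : (ofRoots a b).toAffine.negY x y = -y := by
  simp [negY, ofRoots]

variable [DecidableEq F]

/-- The product of the `x`-coordinates of three collinear points is a square. -/
theorem exists_add_eq_some {x₁ y₁ x₂ y₂ : F} (h₁ : (ofRoots a b).toAffine.Nonsingular x₁ y₁)
    (h₂ : (ofRoots a b).toAffine.Nonsingular x₂ y₂) (hne : ¬(x₁ = x₂ ∧ y₁ = -y₂)) :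
    ∃ x₃ y₃ w, ∃ h₃ : (ofRoots a b).toAffine.Nonsingular x₃ y₃,
      Point.some x₁ y₁ h₁ + Point.some x₂ y₂ h₂ = Point.some x₃ y₃ h₃ ∧
      x₁ * x₂ * x₃ = w ^ 2 := by
  have hne' : ¬(x₁ = x₂ ∧ y₁ = (ofRoots a b).toAffine.negY x₂ y₂) := by rwa [negY_eq]
  refine ⟨_, _, y₁ - (ofRoots a b).toAffine.slope x₁ x₂ y₁ y₂ * x₁, _,
    Point.add_some hne', ?_⟩
  have := congrArg (Polynomial.eval 0) (addPolynomial_slope h₁.1 h₂.1 hne')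
  rw [addPolynomial_eq] at this
  simp [ofRoots, Cubic.toPoly] at this
  simp only [addX, ofRoots] at this ⊢
  linear_combination -this

theorem two_nsmul_some [NeZero (2 : F)] {x y : F} (h : (ofRoots a b).toAffine.Nonsingular x y)
    (hy : y ≠ 0) : ∃ y', ∃ h' : (ofRoots a b).toAffine.Nonsingular
      ((x ^ 2 - a * b) ^ 2 / (2 * y) ^ 2) y',
      2 • Point.some x y h = Point.some _ y' h' := by
  have hne : y ≠ (ofRoots a b).toAffine.negY x y := by
    rw [negY_eq]
    intro h0
    have : 2 * y = 0 := by linear_combination h0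
    exact hy ((mul_eq_zero.1 this).resolve_left two_ne_zero)
  have key : (ofRoots a b).toAffine.addX x x ((ofRoots a b).toAffine.slope x x y y) =
      (x ^ 2 - a * b) ^ 2 / (2 * y) ^ 2 := by
    have h2 := equation_iff.1 h.1
    rw [slope_of_Y_ne rfl hne, negY_eq, sub_neg_eq_add, ← two_mul]
    simp only [addX, ofRoots]
    have : (2 : F) ≠ 0 := two_ne_zero
    field_simp
    linear_combination (-4 * (a + b) - 8 * x) * h2
  rw [two_nsmul, Point.add_self_of_Y_ne hne]
  simp only [← key]
  exact ⟨_, nonsingular_add h h fun hxy => hne hxy.right, rfl⟩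

theorem two_nsmul_eq_zero_iff [NeZero (2 : F)] {x y : F}
    (h : (ofRoots a b).toAffine.Nonsingular x y) : 2 • Point.some x y h = 0 ↔ y = 0 := by
  constructor
  · intro h0
    by_contra hy
    obtain ⟨_, _, h1⟩ := two_nsmul_some h hy
    rw [h1] at h0
    exact Point.some_ne_zero _ h0
  · rintro rfl
    rw [two_nsmul]
    exact Point.add_self_of_Y_eq (by rw [negY_eq, neg_zero])

/-- A point whose three `x`-differences are squares is divisible by two. -/
theorem exists_two_nsmul_eq [NeZero (2 : F)] (ha : a ≠ 0) (hb : b ≠ 0) (hab : b - a ≠ 0)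
    {x y r s t : F} (h : (ofRoots a b).toAffine.Nonsingular x y)
    (hr : x = r ^ 2) (hs : x + a = s ^ 2) (ht : x + b = t ^ 2) :
    ∃ Q : (ofRoots a b).toAffine.Point, 2 • Q = Point.some x y h := by
  have hy := equation_iff.1 h.1
  wlog hrst : y = r * s * t generalizing r
  · refine this (r := -r) (by rw [hr]; ring) ?_
    rw [ht, hs, hr] at hy
    have : (y - r * s * t) * (y + r * s * t) = 0 := by linear_combination hy
    have := (mul_eq_zero.1 this).resolve_left (sub_ne_zero.2 hrst)
    linear_combination this
  have h1 : r + s ≠ 0 := fun h0 => ha (by linear_combination hs - hr + (s - r) * h0)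
  have h2 : r + t ≠ 0 := fun h0 => hb (by linear_combination ht - hr + (t - r) * h0)
  have h3 : s + t ≠ 0 := fun h0 => hab (by linear_combination ht - hs + (t - s) * h0)
  have hQ : (ofRoots a b).toAffine.Nonsingular ((r + s) * (r + t)) ((r + s) * (r + t) * (s + t)) := by
    rw [nonsingular_iff ha hb hab]
    have e1 : (r + s) * (r + t) + a = (r + s) * (s + t) := by linear_combination hs - hr
    have e2 : (r + s) * (r + t) + b = (r + t) * (s + t) := by linear_combination ht - hr
    rw [e1, e2]; ring
  refine ⟨Point.some _ _ hQ, ?_⟩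
  have hne : (r + s) * (r + t) * (s + t) ≠
      (ofRoots a b).toAffine.negY ((r + s) * (r + t)) ((r + s) * (r + t) * (s + t)) := by
    rw [negY_eq]
    intro h0
    have : 2 * ((r + s) * (r + t) * (s + t)) = 0 := by linear_combination h0
    simp only [mul_eq_zero, h1, h2, h3, or_false] at this
    exact two_ne_zero this
  have hsl : (ofRoots a b).toAffine.slope ((r + s) * (r + t)) ((r + s) * (r + t))
      ((r + s) * (r + t) * (s + t)) ((r + s) * (r + t) * (s + t)) = r + s + t := by
    rw [slope_of_Y_ne rfl hne, negY_eq, sub_neg_eq_add, ← two_mul]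
    have : (2 : F) ≠ 0 := two_ne_zero
    have ea : a = s ^ 2 - r ^ 2 := by linear_combination hs - hr
    have eb : b = t ^ 2 - r ^ 2 := by linear_combination ht - hr
    rw [div_eq_iff (by positivity)]
    simp only [ofRoots, ea, eb]
    ring
  rw [two_nsmul, Point.add_self_of_Y_ne hne]
  simp only [hsl, Point.some.injEq]
  have ea : a = s ^ 2 - r ^ 2 := by linear_combination hs - hr
  have eb : b = t ^ 2 - r ^ 2 := by linear_combination ht - hr
  simp only [addY, negY_eq, negAddY, addX]
  simp only [ofRoots, ea, eb, hrst, hr]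
  constructor <;> ring

end WeierstrassCurve.ofRoots

theorem exists_algebraMap_eq_of_sq_eq {R K : Type*} [CommRing R] [CommRing K] [Algebra R K]
    [IsFractionRing R K] [IsIntegrallyClosed R] {x : K} {r : R} (h : x ^ 2 = algebraMap R K r) :
    ∃ y, algebraMap R K y = x :=
  IsIntegrallyClosed.exists_algebraMap_eq_of_isIntegral_pow two_pos (h ▸ isIntegral_algebraMap)

/-- A point of `y² = x (x + a) (x + b)` over the fraction field of a principal ideal domain has
coordinates `(m / e², Y / e³)` with `m` and `e` coprime. -/
theorem exists_eq_div_of_sq_eq {R K : Type*} [CommRing R] [IsDomain R] [IsPrincipalIdealRing R]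
    [Field K] [Algebra R K] [IsFractionRing R K] {a b : R} {x y : K}
    (h : y ^ 2 = x * (x + algebraMap R K a) * (x + algebraMap R K b)) :
    ∃ m e Y : R, e ≠ 0 ∧ IsCoprime m e ∧ x * algebraMap R K e ^ 2 = algebraMap R K m ∧
      y * algebraMap R K e ^ 3 = algebraMap R K Y ∧
      Y ^ 2 = m * ((m + a * e ^ 2) * (m + b * e ^ 2)) := by
  have hinj : Function.Injective (algebraMap R K) := FaithfulSMul.algebraMap_injective R K
  obtain ⟨m, n, hmn, hx⟩ := IsFractionRing.exists_reduced_fraction R x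
  have hn0 : (n : R) ≠ 0 := nonZeroDivisors.ne_zero n.2
  have hn0' : algebraMap R K n ≠ 0 := by simp
  have hx' : x * algebraMap R K n = algebraMap R K m := by
    rw [← hx, IsLocalization.mk'_spec]
  have hcop : IsCoprime m n := hmn.isCoprime
  obtain ⟨Z, hZ⟩ : ∃ Z, algebraMap R K Z = y * algebraMap R K n ^ 2 := by
    apply exists_algebraMap_eq_of_sq_eq (r := n * (m * ((m + a * n) * (m + b * n))))
    simp only [map_mul, map_add, ← hx']
    linear_combination algebraMap R K n ^ 4 * h
  have hZ2 : (n : R) * (m * ((m + a * n) * (m + b * n))) = Z ^ 2 := by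
    apply hinj
    simp only [map_mul, map_add, map_pow, hZ, ← hx']
    linear_combination -algebraMap R K n ^ 4 * h
  have hcop' : IsCoprime (n : R) (m * ((m + a * n) * (m + b * n))) :=
    (hcop.mul_left ((hcop.add_mul_right_left a).mul_left (hcop.add_mul_right_left b))).symm
  obtain ⟨e, v, hv⟩ := exists_associated_pow_of_mul_eq_pow' hcop' hZ2
  have he0 : e ≠ 0 := by
    rintro rfl
    rw [← hv] at hn0
    simp at hn0
  obtain ⟨m', hm'⟩ : ∃ m' : R, m' = m * ↑v⁻¹ := ⟨_, rfl⟩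
  have hxe : x * algebraMap R K e ^ 2 = algebraMap R K m' := by
    rw [hm', map_mul, ← hx', ← hv, map_mul, map_pow]
    have : algebraMap R K v * algebraMap R K ↑v⁻¹ = 1 := by
      rw [← map_mul, Units.mul_inv, map_one]
    linear_combination -x * algebraMap R K e ^ 2 * this
  obtain ⟨Y, hY⟩ : ∃ Y, algebraMap R K Y = y * algebraMap R K e ^ 3 := by
    apply exists_algebraMap_eq_of_sq_eq (r := m' * ((m' + a * e ^ 2) * (m' + b * e ^ 2)))
    simp only [map_mul, map_add, map_pow, ← hxe]
    linear_combination algebraMap R K e ^ 6 * h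
  refine ⟨m', e, Y, he0, ?_, hxe, hY.symm, ?_⟩
  · rw [hm', isCoprime_mul_unit_right_left v⁻¹.isUnit]
    rw [← hv] at hcop
    exact (IsCoprime.pow_right_iff two_pos).1 hcop.of_mul_right_left
  · apply hinj
    simp only [map_mul, map_add, map_pow, ← hxe, hY]
    linear_combination algebraMap R K e ^ 6 * h

namespace TwinParams

set_option linter.unusedSectionVars false

open GaussianInt Zsqrtd WeierstrassCurve WeierstrassCurve.Affine

variable {p q σ α β : ℤ} {π : GaussianInt}
variable {K : Type*} [Field K] [CharZero K] [DecidableEq K] [Algebra GaussianInt K]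

local notation "φ" => algebraMap GaussianInt K

/-- The curve `y² = x (x + α) (x + β)` over the field `K`. -/
abbrev curve (K : Type*) [Field K] (α β : ℤ) : WeierstrassCurve.Affine K :=
  (WeierstrassCurve.ofRoots (α : K) (β : K)).toAffine

theorem equation_map {x y : K} (hxy : (curve K α β).Nonsingular x y) :
    y ^ 2 = x * (x + φ α) * (x + φ β) := by
  simpa using ofRoots.equation_iff.1 hxy.1

theorem ne_zero_of_two_nsmul_ne_zero {x y : K} {hxy : (curve K α β).Nonsingular x y}
    (h2 : 2 • Point.some x y hxy ≠ 0) : y ≠ 0 ∧ x ≠ 0 := by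
  rw [Ne, ofRoots.two_nsmul_eq_zero_iff] at h2
  refine ⟨h2, ?_⟩
  rintro rfl
  have := ofRoots.equation_iff.1 hxy.1
  simp [h2] at this

/-- The point `P` has nonzero `x`-coordinate in the class of `g` modulo squares and units. -/
def HasClass (α β : ℤ) (P : (curve K α β).Point) (g : GaussianInt) : Prop :=
  ∃ (x y : K) (hxy : (curve K α β).Nonsingular x y) (u : GaussianInt) (z : K),
    P = Point.some x y hxy ∧ x ≠ 0 ∧ IsUnit u ∧ x = φ (u * g) * z ^ 2

theorem HasClass.add {P Q : (curve K α β).Point} {g g' : GaussianInt} (hP : HasClass α β P g)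
    (hQ : HasClass α β Q g') (h2 : 2 • (P + Q) ≠ 0) : HasClass α β (P + Q) (g * g') := by
  obtain ⟨x₁, y₁, h₁, u₁, z₁, rfl, hx₁, hu₁, e₁⟩ := hP
  obtain ⟨x₂, y₂, h₂, u₂, z₂, rfl, hx₂, hu₂, e₂⟩ := hQ
  have hne : ¬(x₁ = x₂ ∧ y₁ = -y₂) := by
    rintro ⟨hx, hy⟩
    refine h2 ?_
    rw [Point.add_of_Y_eq hx (by rw [ofRoots.negY_eq, hy]), nsmul_zero]
  obtain ⟨x₃, y₃, w, h₃, hadd, hw⟩ := ofRoots.exists_add_eq_some h₁ h₂ hne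
  rw [hadd] at h2 ⊢
  refine ⟨x₃, y₃, h₃, u₁ * u₂, z₁ * z₂ * (w / (x₁ * x₂)), rfl,
    (ne_zero_of_two_nsmul_ne_zero h2).2, hu₁.mul hu₂, ?_⟩
  have : x₃ = x₁ * x₂ * (w / (x₁ * x₂)) ^ 2 := by
    field_simp
    linear_combination hw
  rw [this]
  nth_rewrite 1 [e₁, e₂]
  simp only [map_mul]
  ring

theorem HasClass.neg {P : (curve K α β).Point} {g : GaussianInt} (hP : HasClass α β P g) :
    HasClass α β (-P) g := by
  obtain ⟨x, y, hxy, u, z, rfl, hx, hu, e⟩ := hP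
  exact ⟨x, _, _, u, z, Point.neg_some hxy, hx, hu, e⟩

theorem HasClass.of_eq_mul_sq {P : (curve K α β).Point} {g g' k v : GaussianInt} (hP : HasClass α β P g)
    (hv : IsUnit v) (hg : g = v * g' * k ^ 2) : HasClass α β P g' := by
  obtain ⟨x, y, hxy, u, z, rfl, hx, hu, e⟩ := hP
  refine ⟨x, y, hxy, u * v, φ k * z, rfl, hx, hu.mul hv, ?_⟩
  rw [e, hg]
  simp only [map_mul, map_pow]
  ring

variable [IsFractionRing GaussianInt K]

section

variable (h : TwinParams p q σ α β π)
include h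

theorem nonsingular_iff {x y : K} :
    (curve K α β).Nonsingular x y ↔ y ^ 2 = x * (x + (α : K)) * (x + (β : K)) := by
  apply ofRoots.nonsingular_iff
  · exact_mod_cast h.α_ne_zero
  · exact_mod_cast h.β_ne_zero
  · exact_mod_cast h.sub_ne_zero

theorem exists_hasClass {P : (curve K α β).Point} (h2 : 2 • P ≠ 0) :
    ∃ a b c : ℕ, a < 2 ∧ b < 2 ∧ c < 2 ∧ HasClass α β P (p ^ a * π ^ b * star π ^ c) := by
  rcases P with _ | ⟨x, y, hxy⟩
  · exact absurd (nsmul_zero 2) h2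
  obtain ⟨hy, hx⟩ := ne_zero_of_two_nsmul_ne_zero h2
  obtain ⟨m, e, Y, he0, hme, hxe, hye, hY⟩ := exists_eq_div_of_sq_eq (equation_map hxy)
  have he0' : φ e ≠ 0 := by simpa using he0
  have hm : m ≠ 0 := by
    rintro rfl
    simp [hx, he0] at hxe
  obtain ⟨u, k, a, b, c, hu, ha, hb, hc, hmk⟩ := h.exists_eq_unit_mul hm hme hY
  refine ⟨a, b, c, ha, hb, hc, x, y, hxy, u, φ k / φ e, rfl, hx, hu, ?_⟩
  have : x = φ m / φ e ^ 2 := by rw [← hxe]; field_simp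
  rw [this, hmk]
  simp only [map_mul, map_pow]
  field_simp

theorem exists_two_nsmul_eq_of_hasClass_one {P : (curve K α β).Point} (h2 : 2 • P ≠ 0)
    (hP : HasClass α β P 1) : ∃ Q, 2 • Q = P := by
  obtain ⟨x, y, hxy, u, z, rfl, hx, hu, ez⟩ := hP
  obtain ⟨hy, -⟩ := ne_zero_of_two_nsmul_ne_zero h2
  obtain ⟨m, e, Y, he0, hme, hxe, hye, hY⟩ := exists_eq_div_of_sq_eq (equation_map hxy)
  have he0' : φ e ≠ 0 := by simpa using he0
  have hinj : Function.Injective φ := FaithfulSMul.algebraMap_injective _ _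
  have hY0 : Y ≠ 0 := by
    rintro rfl
    simp [hy, he0] at hye
  obtain ⟨v, hv⟩ := hu.exists_right_inv
  have hv' : φ u * φ v = 1 := by rw [← map_mul, hv, map_one]
  rw [mul_one] at ez
  obtain ⟨r, hr⟩ : ∃ r, φ r = z * φ e := by
    apply exists_algebraMap_eq_of_sq_eq (r := v * m)
    rw [map_mul, ← hxe, ez]
    linear_combination (-z ^ 2 * φ e ^ 2) * hv'
  have hm : m = u * r ^ 2 := by
    apply hinj
    rw [map_mul, map_pow, hr, ← hxe, ez]
    ring
  obtain ⟨r, s, t, hr, hs, ht⟩ := h.exists_sq_of_eq_unit_mul hme hY0 hu hm hY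
  have hx' : x = φ m / φ e ^ 2 := by rw [← hxe]; field_simp
  refine ofRoots.exists_two_nsmul_eq (r := φ r / φ e) (s := φ s / φ e) (t := φ t / φ e)
    (by exact_mod_cast h.α_ne_zero) (by exact_mod_cast h.β_ne_zero)
    (by exact_mod_cast h.sub_ne_zero) hxy ?_ ?_ ?_
  · rw [hx', hr, map_pow]; field_simp
  · rw [div_pow, ← map_pow, ← hs, hx', map_add, map_mul, map_intCast, map_pow]; field_simp
  · rw [div_pow, ← map_pow, ← ht, hx', map_add, map_mul, map_intCast, map_pow]; field_simp

theorem exists_hasClass_α : ∃ T : (curve K α β).Point, 2 • T = 0 ∧ HasClass α β T (p : GaussianInt) := by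
  have h1 : (curve K α β).Nonsingular (-α : K) 0 := by rw [h.nonsingular_iff]; ring
  refine ⟨Point.some _ _ h1, by rw [ofRoots.two_nsmul_eq_zero_iff], _, _, h1, -σ, 1, rfl, ?_,
    h.isUnit_sign.neg, ?_⟩
  · simpa using h.α_ne_zero
  · rw [h.α_eq]; simp

theorem exists_hasClass_β : ∃ T : (curve K α β).Point, 2 • T = 0 ∧ HasClass α β T (π * star π) := by
  have h1 : (curve K α β).Nonsingular (-β : K) 0 := by rw [h.nonsingular_iff]; ring
  refine ⟨Point.some _ _ h1, by rw [ofRoots.two_nsmul_eq_zero_iff], _, _, h1, -σ, 1, rfl, ?_,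
    h.isUnit_sign.neg, ?_⟩
  · simpa using h.β_ne_zero
  · rw [h.mul_star, h.β_eq]; simp

theorem exists_add_hasClass {P : (curve K α β).Point} (h2 : 2 • P ≠ 0) :
    ∃ T : (curve K α β).Point, 2 • T = 0 ∧ ∃ b < 2, HasClass α β (P + T) (π ^ b) := by
  obtain ⟨a, b, c, ha, hb, hc, hP⟩ := h.exists_hasClass h2
  obtain ⟨T, hT, hTc⟩ := h.exists_hasClass_α (K := K)
  obtain ⟨S, hS, hSc⟩ := h.exists_hasClass_β (K := K)
  have key (k : GaussianInt) {n : ℕ} {Q : (curve K α β).Point} (hn : n < 3)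
      (hQ : HasClass α β Q (π ^ n * k ^ 2)) : ∃ b < 2, HasClass α β Q (π ^ b) := by
    interval_cases n
    · exact ⟨0, by norm_num, hQ.of_eq_mul_sq (k := k) isUnit_one (by ring)⟩
    · exact ⟨1, by norm_num, hQ.of_eq_mul_sq (k := k) isUnit_one (by ring)⟩
    · exact ⟨0, by norm_num, hQ.of_eq_mul_sq (k := π * k) isUnit_one (by ring)⟩
  have hT1 : 2 • (P + T) ≠ 0 := by rwa [smul_add, hT, add_zero]
  have hS1 : 2 • (P + S) ≠ 0 := by rwa [smul_add, hS, add_zero]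
  have hTS : 2 • (P + T + S) ≠ 0 := by rwa [smul_add, hS, add_zero]
  interval_cases a <;> interval_cases c
  · refine ⟨0, nsmul_zero 2, key 1 (show b < 3 by omega) ?_⟩
    rw [add_zero]
    convert hP using 1; ring
  · refine ⟨S, hS, key (star π) (show b + 1 < 3 by omega) ?_⟩
    convert hP.add hSc hS1 using 1; ring
  · refine ⟨T, hT, key p (show b < 3 by omega) ?_⟩
    convert hP.add hTc hT1 using 1; ring
  · refine ⟨T + S, by rw [smul_add, hT, hS, add_zero], key (p * star π)
      (show b + 1 < 3 by omega) ?_⟩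
    rw [← add_assoc]
    convert (hP.add hTc hT1).add hSc hTS using 1; ring

/-- The subgroup generated by the doubles and the two-torsion has index at most two. -/
theorem exists_eq_two_nsmul_add (P Q : (curve K α β).Point) :
    (∃ R T : (curve K α β).Point, 2 • T = 0 ∧ P = 2 • R + T) ∨
      (∃ R T : (curve K α β).Point, 2 • T = 0 ∧ Q = 2 • R + T) ∨
      ∃ R T : (curve K α β).Point, 2 • T = 0 ∧ P - Q = 2 • R + T := by
  have htriv (P : (curve K α β).Point) (h2 : 2 • P = 0) :
      ∃ R T : (curve K α β).Point, 2 • T = 0 ∧ P = 2 • R + T :=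
    ⟨0, P, h2, by simp⟩
  have hhalf (P T : (curve K α β).Point) (h2 : 2 • P ≠ 0) (hT : 2 • T = 0) (hc : HasClass α β (P + T) 1) :
      ∃ R T : (curve K α β).Point, 2 • T = 0 ∧ P = 2 • R + T := by
    obtain ⟨R, hR⟩ := h.exists_two_nsmul_eq_of_hasClass_one (by rwa [smul_add, hT, add_zero]) hc
    exact ⟨R, -T, by rw [smul_neg, hT, neg_zero], by rw [hR, add_neg_cancel_right]⟩
  by_cases hP : 2 • P = 0
  · exact .inl (htriv P hP)
  by_cases hQ : 2 • Q = 0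
  · exact .inr (.inl (htriv Q hQ))
  obtain ⟨T, hT, a, ha, hTa⟩ := h.exists_add_hasClass hP
  obtain ⟨S, hS, b, hb, hSb⟩ := h.exists_add_hasClass hQ
  interval_cases a
  · exact .inl (hhalf P T hP hT (by simpa using hTa))
  interval_cases b
  · exact .inr (.inl (hhalf Q S hQ hS (by simpa using hSb)))
  refine .inr (.inr ?_)
  by_cases hPQ : 2 • (P - Q) = 0
  · exact htriv _ hPQ
  have e : P - Q + (T - S) = (P + T) + -(Q + S) := by abel
  have hTS : 2 • (T - S) = 0 := by rw [smul_sub, hT, hS, sub_zero]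
  refine hhalf (P - Q) (T - S) hPQ hTS ?_
  rw [e]
  refine (hTa.add hSb.neg ?_).of_eq_mul_sq (k := π) isUnit_one (by ring)
  rwa [← e, smul_add, hTS, add_zero]

end

end TwinParams

namespace TwinParams

open GaussianInt Zsqrtd WeierstrassCurve WeierstrassCurve.Affine

set_option linter.unusedSectionVars false

variable {p q σ α β : ℤ} {π : GaussianInt}
variable {K : Type*} [Field K] [CharZero K] [DecidableEq K] [Algebra GaussianInt K]
  [IsFractionRing GaussianInt K]

local notation "φ" => algebraMap GaussianInt K

/-- The `x`-coordinate of `P` has a pole of order at least `2 * k` at the prime `1 + i`. -/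
def HasPole (α β : ℤ) (k : ℕ) (P : (curve K α β).Point) : Prop :=
  ∃ (x y : K) (hxy : (curve K α β).Nonsingular x y) (n m : GaussianInt),
    P = Point.some x y hxy ∧ x * φ m ^ 2 = φ n ∧ ¬ oneAddI ∣ n ∧ oneAddI ^ k ∣ m ∧ m ≠ 0

theorem oneAddI_dvd_two : oneAddI ∣ 2 := by
  rw [oneAddI_dvd_iff]; simp

section

variable (h : TwinParams p q σ α β π)
include h

/-- Three differences of coordinates of the double of a point are squares. -/
theorem exists_sq_of_two_nsmul {Q : (curve K α β).Point} {x y : K}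
    {hxy : (curve K α β).Nonsingular x y} (hQ : 2 • Q = Point.some x y hxy) {m e : GaussianInt}
    (hx : x * φ e ^ 2 = φ m) :
    ∃ r s t, m = r ^ 2 ∧ m + α * e ^ 2 = s ^ 2 ∧ m + β * e ^ 2 = t ^ 2 := by
  have hinj : Function.Injective φ := FaithfulSMul.algebraMap_injective _ _
  have aux {γ : ℤ} {z : K} (hz : x + γ = z ^ 2) : ∃ r, m + γ * e ^ 2 = r ^ 2 := by
    obtain ⟨r, hr⟩ : ∃ r, φ r = z * φ e := by
      apply exists_algebraMap_eq_of_sq_eq (r := m + γ * e ^ 2)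
      rw [map_add, map_mul, map_intCast, map_pow, ← hx, mul_pow, ← hz]
      ring
    refine ⟨r, hinj ?_⟩
    rw [map_add, map_mul, map_intCast, map_pow, ← hx, map_pow, hr, mul_pow, ← hz]
    ring
  rcases Q with _ | ⟨X, Y, hXY⟩
  · exact absurd ((nsmul_zero 2).symm.trans hQ).symm (Point.some_ne_zero _)
  have hY : Y ≠ 0 := by
    intro h0
    rw [(ofRoots.two_nsmul_eq_zero_iff hXY).2 h0] at hQ
    exact Point.some_ne_zero _ hQ.symm
  obtain ⟨y', h', e'⟩ := ofRoots.two_nsmul_some hXY hY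
  rw [hQ, Point.some.injEq] at e'
  have hE := h.nonsingular_iff.1 hXY
  obtain ⟨r, hr⟩ := aux (γ := 0) (z := (X ^ 2 - α * β) / (2 * Y)) (by
    rw [e'.1]; push_cast; field_simp; ring)
  obtain ⟨s, hs⟩ := aux (γ := α) (z := (X ^ 2 + 2 * α * X + α * β) / (2 * Y)) (by
    rw [e'.1]; field_simp; linear_combination 4 * α * hE)
  obtain ⟨t, ht⟩ := aux (γ := β) (z := (X ^ 2 + 2 * β * X + α * β) / (2 * Y)) (by
    rw [e'.1]; field_simp; linear_combination 4 * β * hE)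
  exact ⟨r, s, t, by simpa using hr, hs, ht⟩

theorem two_nsmul_ne_zero_and_hasPole {P Q : (curve K α β).Point} (hQ : 2 • Q = P) (hP : P ≠ 0) :
    2 • P ≠ 0 ∧ HasPole α β 1 (2 • P) := by
  have hinj : Function.Injective φ := FaithfulSMul.algebraMap_injective _ _
  rcases P with _ | ⟨x, y, hxy⟩
  · exact absurd rfl hP
  obtain ⟨m, e, Y, he0, hme, hxe, hye, hY⟩ := exists_eq_div_of_sq_eq (equation_map hxy)
  obtain ⟨r, s, t, hr, hs, ht⟩ := h.exists_sq_of_two_nsmul hQ hxe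
  have he0' : φ e ≠ 0 := by simpa using he0
  have hre : IsCoprime r e := by
    rw [hr] at hme
    exact (IsCoprime.pow_left_iff two_pos).1 hme
  have hse : IsCoprime s e := by
    rw [← IsCoprime.pow_left_iff two_pos, ← hs, pow_two e, ← mul_assoc]
    exact hme.add_mul_right_left _
  have hY0 : Y ≠ 0 := by
    rintro rfl
    rw [hs, ht, hr] at hY
    have : r = 0 ∨ s = 0 ∨ t = 0 := by simpa using hY.symm
    rcases this with rfl | rfl | rfl
    · refine h.sq_ne_α_mul_sq isUnit_one hse ?_
      linear_combination hr - hs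
    · refine h.sq_ne_α_mul_sq isUnit_one.neg hre ?_
      linear_combination hs - hr
    · refine h.sq_ne_β_mul_sq isUnit_one.neg hre ?_
      linear_combination ht - hr
  have hy : y ≠ 0 := by
    rintro rfl
    rw [zero_mul, eq_comm, map_eq_zero_iff _ hinj] at hye
    exact hY0 hye
  refine ⟨by rwa [Ne, ofRoots.two_nsmul_eq_zero_iff], ?_⟩
  obtain ⟨y', h', e'⟩ := ofRoots.two_nsmul_some hxy hy
  refine ⟨_, y', h', (m ^ 2 - α * β * e ^ 4) ^ 2, 2 * Y * e, e', ?_, ?_, ?_, ?_⟩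
  · simp only [map_mul, map_sub, map_pow, map_intCast, map_ofNat, ← hxe, ← hye]
    field_simp
  · intro hd
    have hd := prime_oneAddI.dvd_of_dvd_pow hd
    rcases h.oneAddI_dvd_or_dvd_of_sq (hr ▸ hs) (hr ▸ ht) with h1 | h1
    · have h2 : oneAddI ∣ m ^ 2 := by
        rw [hr]
        exact (h1.trans (dvd_pow_self _ two_ne_zero)).trans (dvd_pow_self _ two_ne_zero)
      rw [dvd_sub_right h2, prime_oneAddI.dvd_mul, prime_oneAddI.dvd_mul] at hd
      rcases hd with (hd | hd) | hd
      · exact h.not_oneAddI_dvd_α hd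
      · exact h.not_oneAddI_dvd_β hd
      · exact prime_oneAddI.not_isUnit (hre.isUnit_of_dvd' h1 (prime_oneAddI.dvd_of_dvd_pow hd))
    · have h4 : oneAddI ∣ (α : GaussianInt) * β * e ^ 4 :=
        (h1.trans (dvd_pow_self _ four_ne_zero)).mul_left _
      rw [dvd_sub_left h4] at hd
      exact prime_oneAddI.not_isUnit (hme.isUnit_of_dvd' (prime_oneAddI.dvd_of_dvd_pow hd) h1)
  · rw [pow_one]
    exact (oneAddI_dvd_two.mul_right _).mul_right _
  · simp [hY0, he0]

theorem HasPole.two_nsmul {P : (curve K α β).Point} {k : ℕ} (hk : k ≠ 0)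
    (hP : HasPole α β k P) : HasPole α β (k + 1) (2 • P) := by
  obtain ⟨x, y, hxy, n, m, rfl, hx, hn, hm, hm0⟩ := hP
  have hinj : Function.Injective φ := FaithfulSMul.algebraMap_injective _ _
  have hE := equation_map hxy
  have hm0' : φ m ≠ 0 := by simpa using hm0
  have hm1 : oneAddI ∣ m := (dvd_pow_self _ hk).trans hm
  obtain ⟨Y, hY⟩ : ∃ Y, φ Y = y * φ m ^ 3 := by
    apply exists_algebraMap_eq_of_sq_eq (r := n * (n + α * m ^ 2) * (n + β * m ^ 2))
    simp only [map_mul, map_add, map_pow, ← hx]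
    linear_combination φ m ^ 6 * hE
  have hY2 : Y ^ 2 = n * (n + α * m ^ 2) * (n + β * m ^ 2) := by
    apply hinj
    simp only [map_mul, map_add, map_pow, ← hx, hY]
    linear_combination φ m ^ 6 * hE
  have hm2 (γ : ℤ) : oneAddI ∣ γ * m ^ 2 := (hm1.trans (dvd_pow_self _ two_ne_zero)).mul_left _
  have hYd : ¬ oneAddI ∣ Y := by
    intro hd
    have hd : oneAddI ∣ Y ^ 2 := hd.trans (dvd_pow_self _ two_ne_zero)
    rw [hY2, prime_oneAddI.dvd_mul, prime_oneAddI.dvd_mul, dvd_add_left (hm2 α),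
      dvd_add_left (hm2 β)] at hd
    tauto
  have hY0 : Y ≠ 0 := by
    rintro rfl
    exact hYd (dvd_zero _)
  have hy : y ≠ 0 := by
    rintro rfl
    rw [zero_mul, map_eq_zero_iff _ hinj] at hY
    exact hY0 hY
  obtain ⟨y', h', e'⟩ := ofRoots.two_nsmul_some hxy hy
  refine ⟨_, y', h', (n ^ 2 - α * β * m ^ 4) ^ 2, 2 * Y * m, e', ?_, ?_, ?_, ?_⟩
  · simp only [map_mul, map_sub, map_pow, map_intCast, map_ofNat, ← hx, hY]
    field_simp
  · intro hd
    have hd := prime_oneAddI.dvd_of_dvd_pow hd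
    have h4 : oneAddI ∣ (α : GaussianInt) * β * m ^ 4 :=
      (hm1.trans (dvd_pow_self _ four_ne_zero)).mul_left _
    exact hn (prime_oneAddI.dvd_of_dvd_pow ((dvd_sub_left h4).1 hd))
  · rw [pow_succ']
    exact mul_dvd_mul (oneAddI_dvd_two.mul_right _) hm
  · simp [hY0, hm0]

end

theorem exists_not_hasPole (P : (curve K α β).Point) : ∃ n : ℕ, ∀ k > n, ¬ HasPole α β k P := by
  by_cases hP : ∃ k, HasPole α β k P
  swap
  · exact ⟨0, fun k _ hk => hP ⟨k, hk⟩⟩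
  obtain ⟨_, x, y, hxy, n, m, rfl, hx, hn, -, hm0⟩ := hP
  have hinj : Function.Injective φ := FaithfulSMul.algebraMap_injective _ _
  obtain ⟨l, hl⟩ := FiniteMultiplicity.of_prime_left prime_oneAddI hm0
  refine ⟨l, ?_⟩
  rintro k hk ⟨x', y', hxy', n', m', e, hx', hn', hm', -⟩
  rw [Point.some.injEq] at e
  obtain ⟨rfl, rfl⟩ := e
  have e : n * m' ^ 2 = m ^ 2 * n' := by
    apply hinj
    simp only [map_mul, map_pow, ← hx, ← hx']
    ring
  have h1 : (oneAddI ^ k) ^ 2 ∣ m ^ 2 * n' := e ▸ (pow_dvd_pow_of_dvd hm' 2).mul_left n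
  rw [← pow_mul] at h1
  have h2 := prime_oneAddI.pow_dvd_of_dvd_mul_right _ hn' h1
  rw [pow_mul, IsIntegrallyClosed.pow_dvd_pow_iff two_ne_zero] at h2
  exact hl ((pow_dvd_pow _ hk).trans h2)

variable (h : TwinParams p q σ α β π)
include h

/-- A point divisible by two that has finite order is zero. -/
theorem eq_zero_of_isOfFinAddOrder {Q : (curve K α β).Point} (hQ : IsOfFinAddOrder (2 • Q)) :
    2 • Q = 0 := by
  by_contra h0
  obtain ⟨-, h1⟩ := h.two_nsmul_ne_zero_and_hasPole rfl h0
  have hp (k : ℕ) : HasPole α β (k + 1) (2 ^ k • 2 • 2 • Q) := by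
    induction k with
    | zero => simpa using h1
    | succ k ih =>
      have := HasPole.two_nsmul (P := 2 ^ k • 2 • 2 • Q) h k.succ_ne_zero ih
      rwa [← mul_smul, ← pow_succ'] at this
  have hfin : Finite (AddSubgroup.zmultiples (2 • Q)) := hQ.finite_zmultiples
  obtain ⟨R, hR⟩ := Finite.exists_infinite_fiber
    fun k : ℕ => (⟨2 ^ k • 2 • 2 • Q,
      nsmul_mem (nsmul_mem (AddSubgroup.mem_zmultiples _) 2) (2 ^ k)⟩ :
      AddSubgroup.zmultiples (2 • Q))
  obtain ⟨n, hn⟩ := exists_not_hasPole R.1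
  obtain ⟨k, hk, hkn⟩ := (Set.infinite_coe_iff.1 hR).exists_gt n
  refine hn (k + 1) (by omega) ?_
  have hkR : 2 ^ k • 2 • 2 • Q = R.1 := congrArg Subtype.val hk
  rw [← hkR]
  exact hp k

end TwinParams

namespace WeierstrassCurve.ofRoots

open WeierstrassCurve.Affine MvPolynomial

section

variable {F : Type*} [Field F] {a b : F}

theorem eval_addSubMap (x : Fin 3 → F) :
    (fun i => (addSubMap (ofRoots a b) i).eval x) =
      ![x 0 ^ 2 - 2 * a * b * x 0 * x 2 + (a * b) ^ 2 * x 2 ^ 2,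
        2 * x 1 * x 0 + 4 * (a + b) * x 0 * x 2 + 2 * a * b * x 1 * x 2,
        x 1 ^ 2 - 4 * x 0 * x 2] := by
  ext i
  fin_cases i <;> simp [addSubMap, ofRoots, b₂, b₄, b₆, b₈] <;> ring_nf <;> simp

variable [DecidableEq F]

/-- The map `addSubMap` computes the symmetric square of `x (P + P)` and `x (P - P)`. -/
theorem exists_eval_addSubMap_self [NeZero (2 : F)] (ha : a ≠ 0) (hb : b ≠ 0) (hab : b - a ≠ 0)
    {x y : F} (h : (ofRoots a b).toAffine.Nonsingular x y) :
    ∃ c : F, c ≠ 0 ∧ (fun i => (addSubMap (ofRoots a b) i).eval ![x * x, x + x, 1]) =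
      c • (Point.some x y h + Point.some x y h).sym2x 0 := by
  have hE := equation_iff.1 h.1
  have e (u v : F) : u • ![v, 1, 0] = ![u * v, u, 0] := by simp
  have h2 : (2 : F) ≠ 0 := two_ne_zero
  rw [eval_addSubMap, ← two_nsmul (Point.some x y h)]
  by_cases hy : y = 0
  · rw [(two_nsmul_eq_zero_iff h).2 hy, Point.sym2x_zero_zero]
    subst hy
    refine ⟨(x ^ 2 - a * b) ^ 2, ?_, ?_⟩
    · intro h0
      have h0 : x ^ 2 - a * b = 0 := by simpa using h0
      have h1 : x = 0 ∨ x + a = 0 ∨ x + b = 0 := by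
        simpa [or_assoc] using hE
      rcases h1 with h1 | h1 | h1
      · have : a * b = 0 := by linear_combination x * h1 - h0
        simp [ha, hb] at this
      · have : a * (b - a) = 0 := by linear_combination (x - a) * h1 - h0
        simp [ha, hab] at this
      · have : b * (b - a) = 0 := by linear_combination - (x - b) * h1 + h0
        simp [hb, hab] at this
    · ext i
      fin_cases i <;> simp
      · ring
      · linear_combination -4 * hE
      · ring
  · obtain ⟨y', h', e'⟩ := two_nsmul_some h hy
    rw [e', Point.sym2x_some_zero]
    refine ⟨(2 * y) ^ 2, by simp [hy, h2], ?_⟩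
    ext i
    fin_cases i <;> simp
    · field_simp
      ring
    · linear_combination -4 * hE
    · ring

/-- The map `addSubMap` computes `x (P + Q) * x (P - Q)` and `x (P + Q) + x (P - Q)`. -/
theorem exists_eval_addSubMap [NeZero (2 : F)] (ha : a ≠ 0) (hb : b ≠ 0) (hab : b - a ≠ 0)
    (P Q : (ofRoots a b).toAffine.Point) :
    ∃ c : F, c ≠ 0 ∧ (fun i => (addSubMap (ofRoots a b) i).eval (P.sym2x Q)) =
      c • (P + Q).sym2x (P - Q) := by
  rcases P with _ | ⟨x₁, y₁, h₁⟩ <;> rcases Q with _ | ⟨x₂, y₂, h₂⟩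
  · refine ⟨1, one_ne_zero, ?_⟩
    rw [eval_addSubMap, one_smul, ← Point.zero_def, zero_add, zero_sub, Point.sym2x_neg_right,
      Point.sym2x_zero_zero]
    simp
  · refine ⟨1, one_ne_zero, ?_⟩
    rw [eval_addSubMap, one_smul, ← Point.zero_def, zero_add, zero_sub, Point.sym2x_neg_right,
      Point.sym2x_zero_some, Point.sym2x_some_some]
    simp [pow_two, two_mul]
  · refine ⟨1, one_ne_zero, ?_⟩
    rw [eval_addSubMap, one_smul, ← Point.zero_def, add_zero, sub_zero, Point.sym2x_some_zero,
      Point.sym2x_some_some]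
    simp [pow_two, two_mul]
  rw [Point.sym2x_some_some]
  by_cases hx : x₁ = x₂
  · subst hx
    rcases (Point.X_eq_iff (h₁ := h₁) (h₂ := h₂)).1 rfl with e | e
    · rw [e, sub_self]
      exact exists_eval_addSubMap_self ha hb hab h₂
    · rw [e, neg_add_cancel, Point.sym2x_comm, ← neg_add', Point.sym2x_neg_left]
      exact exists_eval_addSubMap_self ha hb hab h₂
  · have hx' : x₁ - x₂ ≠ 0 := sub_ne_zero.2 hx
    have hE₁ := equation_iff.1 h₁.1
    have hE₂ := equation_iff.1 h₂.1
    rw [sub_eq_add_neg, Point.neg_some, Point.add_of_X_ne hx, Point.add_of_X_ne hx,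
      Point.sym2x_some_some, eval_addSubMap]
    refine ⟨(x₁ - x₂) ^ 2, pow_ne_zero 2 hx', ?_⟩
    simp only [slope_of_X_ne hx, negY_eq, addX]
    have A : (ofRoots a b).a₁ = 0 := rfl
    have B : (ofRoots a b).a₂ = a + b := rfl
    simp only [A, B]
    ext i
    fin_cases i <;> simp
    · field_simp
      linear_combination (-(y₁ ^ 2 - y₂ ^ 2 + x₁ * (x₁ + a) * (x₁ + b) - x₂ * (x₂ + a) * (x₂ + b)) +
          2 * (x₁ - x₂) ^ 2 * (a + b + x₁ + x₂)) * hE₁ +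
        (y₁ ^ 2 - y₂ ^ 2 + x₁ * (x₁ + a) * (x₁ + b) - x₂ * (x₂ + a) * (x₂ + b) +
          2 * (x₁ - x₂) ^ 2 * (a + b + x₁ + x₂)) * hE₂
    · field_simp
      linear_combination -2 * hE₁ - 2 * hE₂
    · ring

end

open Height

variable {K : Type*} [Field K] [NumberField K] [DecidableEq K] {a b : K}

theorem fg_of_finiteIndex (ha : a ≠ 0) (hb : b ≠ 0) (hab : b - a ≠ 0)
    (hfin : (nsmulAddMonoidHom (α := (ofRoots a b).toAffine.Point) 2).range.FiniteIndex) :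
    AddGroup.FG (ofRoots a b).toAffine.Point := by
  have : (ofRoots a b).IsElliptic := ⟨(Δ_ne_zero ha hb hab).isUnit⟩
  obtain ⟨C₁, hC₁⟩ := abs_logHeight_addSubMap_sub_two_mul_logHeight_le (ofRoots a b)
  obtain ⟨C₂, hC₂⟩ := abs_logHeight_sym2_sub_le (K := K)
  have hsym (P Q : (ofRoots a b).toAffine.Point) :
      |logHeight (P.sym2x Q) - (logHeight P.xRep + logHeight Q.xRep)| ≤ C₂ := by
    have hP : P.xRep = ![P.xRep 0, P.xRep 1] := by ext i; fin_cases i <;> rfl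
    have hQ : Q.xRep = ![Q.xRep 0, Q.xRep 1] := by ext i; fin_cases i <;> rfl
    rw [hP, hQ]
    exact hC₂ (hP ▸ P.xRep_ne_zero) (hQ ▸ Q.xRep_ne_zero)
  have : Northcott fun P : (ofRoots a b).toAffine.Point => logHeight P.xRep := by
    refine ⟨fun B => ?_⟩
    have hB : Set.Finite {x : K | logHeight₁ x ≤ B} := Northcott.finite_le B
    refine Set.Finite.of_finite_fibers (f := fun P : (ofRoots a b).toAffine.Point => P.xRep) ?_ ?_
    · refine ((hB.image fun x => ![x, 1]).insert ![1, 0]).subset ?_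
      rintro _ ⟨_ | ⟨x, y, h⟩, hP, rfl⟩
      · exact .inl rfl
      · exact .inr ⟨x, by simpa [logHeight₁_eq_logHeight] using hP, rfl⟩
    · rintro _ ⟨P, -, rfl⟩
      refine (Set.toFinite {P, -P}).subset ?_
      rintro Q ⟨-, hQ⟩
      exact Point.xRep_eq_xRep_iff.1 hQ
  refine AddCommGroup.fg_of_descent' (h := fun P => logHeight P.xRep) (C := C₁ + 3 * C₂) hfin
    (fun P => logHeight_nonneg _) fun P Q => ?_
  obtain ⟨c, hc, e⟩ := exists_eval_addSubMap ha hb hab P Q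
  have h₁ := hC₁ (P.sym2x Q)
  rw [e, logHeight_smul_eq_logHeight _ hc] at h₁
  have h₂ := hsym P Q
  have h₃ := hsym (P + Q) (P - Q)
  rw [abs_le] at *
  constructor <;> linarith

end WeierstrassCurve.ofRoots

section

variable {G : Type*} [AddCommGroup G]

/-- If doubles and two-torsion generate a subgroup of index at most two, and the two-torsion is
finite, then the subgroup of doubles has finite index. -/
theorem finiteIndex_range_two_nsmul [Finite (nsmulAddMonoidHom (α := G) 2).ker]
    (h : ∀ P Q : G, (∃ R T : G, 2 • T = 0 ∧ P = 2 • R + T) ∨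
      (∃ R T : G, 2 • T = 0 ∧ Q = 2 • R + T) ∨ ∃ R T : G, 2 • T = 0 ∧ P - Q = 2 • R + T) :
    (nsmulAddMonoidHom (α := G) 2).range.FiniteIndex := by
  obtain ⟨P₀, hP₀⟩ : ∃ P₀ : G, ∀ P, ∃ R T : G, 2 • T = 0 ∧ (P = 2 • R + T ∨
      P = 2 • R + (P₀ + T)) := by
    by_cases hall : ∀ P : G, ∃ R T : G, 2 • T = 0 ∧ P = 2 • R + T
    · refine ⟨0, fun P => ?_⟩
      obtain ⟨R, T, hT, hP⟩ := hall P
      exact ⟨R, T, hT, .inl hP⟩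
    · push Not at hall
      obtain ⟨P₀, hP₀⟩ := hall
      refine ⟨P₀, fun P => ?_⟩
      rcases h P P₀ with ⟨R, T, hT, hP⟩ | ⟨R, T, hT, hP⟩ | ⟨R, T, hT, hP⟩
      · exact ⟨R, T, hT, .inl hP⟩
      · exact absurd hP (hP₀ R T hT)
      · exact ⟨R, T, hT, .inr (by rw [add_left_comm, ← hP, add_sub_cancel])⟩
  have : Finite (G ⧸ (nsmulAddMonoidHom (α := G) 2).range) := by
    refine Finite.of_surjective (α := (nsmulAddMonoidHom (α := G) 2).ker × Bool)
      (fun x => ((if x.2 then P₀ + x.1 else x.1 : G) : G ⧸ _)) ?_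
    intro x
    obtain ⟨P, rfl⟩ := QuotientAddGroup.mk_surjective x
    obtain ⟨R, T, hT, hP | hP⟩ := hP₀ P
    · refine ⟨(⟨T, hT⟩, false), ?_⟩
      rw [QuotientAddGroup.eq]
      exact ⟨R, by simp [hP]⟩
    · refine ⟨(⟨T, hT⟩, true), ?_⟩
      rw [QuotientAddGroup.eq]
      exact ⟨R, by simp [hP]; abel⟩
  exact AddSubgroup.finiteIndex_of_finite_quotient

/-- A finitely generated torsion-free abelian group `F ≠ 0` with `F / 2F` of order at most two is
infinite cyclic. -/
theorem nonempty_addEquiv_int_of_two_nsmul {F : Type*} [AddCommGroup F] [Nontrivial F]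
    [AddGroup.FG F] [IsAddTorsionFree F]
    (h : ∀ f g : F, (∃ k, f = 2 • k) ∨ (∃ k, g = 2 • k) ∨ ∃ k, f - g = 2 • k) :
    Nonempty (F ≃+ ℤ) := by
  have : Module.Finite ℤ F := Module.Finite.iff_addGroup_fg.2 ‹_›
  have : Module.Free ℤ F := Module.free_of_finite_type_torsion_free'
  let b := Module.Free.chooseBasis ℤ F
  have hsub : Subsingleton (Module.Free.ChooseBasisIndex ℤ F) := by
    refine ⟨fun i j => ?_⟩
    by_contra hij
    rcases h (b i) (b j) with ⟨k, hk⟩ | ⟨k, hk⟩ | ⟨k, hk⟩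
    · have := congrArg (fun x => b.repr x i) hk
      simp at this
      omega
    · have := congrArg (fun x => b.repr x j) hk
      simp at this
      omega
    · have := congrArg (fun x => b.repr x i) hk
      simp [hij] at this
      omega
  have hne : Nonempty (Module.Free.ChooseBasisIndex ℤ F) := b.index_nonempty
  have : Unique (Module.Free.ChooseBasisIndex ℤ F) := uniqueOfSubsingleton hne.some
  exact ⟨(b.equivFun.trans (LinearEquiv.funUnique _ ℤ ℤ)).toAddEquiv⟩

/-- A surjection from an abelian group onto `ℤ` splits. -/
theorem nonempty_addEquiv_ker_prod (g : G →+ ℤ) (hg : Function.Surjective g) :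
    Nonempty (G ≃+ g.ker × ℤ) := by
  obtain ⟨P, hP⟩ := hg 1
  refine ⟨(AddEquiv.ofBijective (g.ker.subtype.coprod (zmultiplesHom G P)) ⟨?_, fun Q => ?_⟩).symm⟩
  · rw [injective_iff_map_eq_zero]
    rintro ⟨⟨T, hT⟩, n⟩ h0
    have h1 := congrArg g h0
    rw [AddMonoidHom.mem_ker] at hT
    simp [hT, hP] at h1
    subst h1
    simpa using h0
  · exact ⟨(⟨Q - g Q • P, by simp [AddMonoidHom.mem_ker, hP]⟩, g Q), by simp⟩

theorem nonempty_addEquiv_of_two_nsmul (hfg : AddGroup.FG G)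
    [IsAddKleinFour (nsmulAddMonoidHom (α := G) 2).ker]
    (htors : ∀ Q : G, IsOfFinAddOrder (2 • Q) → 2 • Q = 0)
    (h : ∀ P Q : G, (∃ R T : G, 2 • T = 0 ∧ P = 2 • R + T) ∨
      (∃ R T : G, 2 • T = 0 ∧ Q = 2 • R + T) ∨ ∃ R T : G, 2 • T = 0 ∧ P - Q = 2 • R + T)
    {P : G} (hP : 2 • P ≠ 0) : Nonempty (G ≃+ ZMod 2 × ZMod 2 × ℤ) := by
  let f := nsmulAddMonoidHom (α := G) 2
  have hdouble {Q R T : G} (hT : 2 • T = 0) (hQ : Q = 2 • R + T) : f Q = 2 • f R := by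
    change 2 • Q = 2 • 2 • R
    rw [hQ, smul_add, hT, add_zero]
  have : AddGroup.FG f.range := AddGroup.fg_range f
  have : Nontrivial f.range := ⟨⟨f P, P, rfl⟩, 0, fun h0 => hP (congrArg Subtype.val h0)⟩
  have : IsAddTorsionFree f.range := by
    rw [isAddTorsionFree_iff_not_isOfFinAddOrder]
    rintro ⟨_, Q, rfl⟩ hne hfin
    refine hne (Subtype.ext (htors Q ?_))
    exact AddSubmonoid.isOfFinAddOrder_coe.2 hfin
  obtain ⟨e⟩ := nonempty_addEquiv_int_of_two_nsmul (F := f.range) (by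
    rintro ⟨_, Q, rfl⟩ ⟨_, Q', rfl⟩
    rcases h Q Q' with ⟨R, T, hT, hQ⟩ | ⟨R, T, hT, hQ⟩ | ⟨R, T, hT, hQ⟩
    · exact .inl ⟨⟨f R, R, rfl⟩, Subtype.ext (hdouble hT hQ)⟩
    · exact .inr (.inl ⟨⟨f R, R, rfl⟩, Subtype.ext (hdouble hT hQ)⟩)
    · refine .inr (.inr ⟨⟨f R, R, rfl⟩, Subtype.ext ?_⟩)
      exact (map_sub f Q Q').symm.trans (hdouble hT hQ))
  let g : G →+ ℤ := e.toAddMonoidHom.comp f.rangeRestrict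
  obtain ⟨e'⟩ := nonempty_addEquiv_ker_prod g (e.surjective.comp f.rangeRestrict_surjective)
  have hker : g.ker = f.ker := by
    ext Q
    simp [g, AddMonoidHom.mem_ker, f]
  have : IsAddKleinFour g.ker := hker ▸ ‹IsAddKleinFour f.ker›
  obtain ⟨k⟩ := IsAddKleinFour.nonempty_addEquiv (G₁ := g.ker) (G₂ := ZMod 2 × ZMod 2)
  exact ⟨(e'.trans (k.prodCongr (.refl ℤ))).trans AddEquiv.prodAssoc⟩

end

namespace WeierstrassCurve.ofRoots

open WeierstrassCurve.Affine

variable {F : Type*} [Field F] [NeZero (2 : F)] [DecidableEq F] {a b : F}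

theorem isAddKleinFour (ha : a ≠ 0) (hb : b ≠ 0) (hab : b - a ≠ 0) :
    IsAddKleinFour (nsmulAddMonoidHom (α := (ofRoots a b).toAffine.Point) 2).ker := by
  have hA : (ofRoots a b).toAffine.Nonsingular 0 0 := by rw [nonsingular_iff ha hb hab]; ring
  have hB : (ofRoots a b).toAffine.Nonsingular (-a) 0 := by rw [nonsingular_iff ha hb hab]; ring
  have hC : (ofRoots a b).toAffine.Nonsingular (-b) 0 := by rw [nonsingular_iff ha hb hab]; ring
  have hset : ((nsmulAddMonoidHom (α := (ofRoots a b).toAffine.Point) 2).ker : Set _) =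
      {0, Point.some _ _ hA, Point.some _ _ hB, Point.some _ _ hC} := by
    ext P
    rcases P with _ | ⟨x, y, hxy⟩
    · simp [← Point.zero_def]
    · have h2 : Point.some x y hxy ∈ (nsmulAddMonoidHom (α := (ofRoots a b).toAffine.Point) 2).ker ↔
        y = 0 := two_nsmul_eq_zero_iff hxy
      have hE := equation_iff.1 hxy.1
      simp only [SetLike.mem_coe, h2, Set.mem_insert_iff, Point.some_ne_zero, false_or,
        Set.mem_singleton_iff, Point.some.injEq, ← or_and_right, iff_and_self]
      rintro rfl
      simpa [add_eq_zero_iff_eq_neg, or_assoc] using hE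
  have hba : -a ≠ -b := fun h0 => hab (by linear_combination h0)
  have hcard : Nat.card (nsmulAddMonoidHom (α := (ofRoots a b).toAffine.Point) 2).ker = 4 := by
    rw [← SetLike.coe_sort_coe, hset, Nat.card_coe_set_eq, Set.ncard_insert_of_notMem,
      Set.ncard_insert_of_notMem, Set.ncard_pair]
    · simp [hba]
    · simp [ha, hb]
    · simp [(Point.some_ne_zero _).symm]
  have : Nontrivial (nsmulAddMonoidHom (α := (ofRoots a b).toAffine.Point) 2).ker :=
    have := Nat.finite_of_card_ne_zero (hcard.trans_ne four_ne_zero)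
    Finite.one_lt_card_iff_nontrivial.1 (by rw [hcard]; norm_num)
  refine ⟨hcard, (AddMonoid.exponent_eq_prime_iff Nat.prime_two).2 fun T hT => ?_⟩
  exact addOrderOf_eq_prime (Subtype.ext T.2) hT

end WeierstrassCurve.ofRoots

namespace GaussField

/-- The square root of `-1` in the Gauss field. -/
noncomputable def I : GaussField :=
  ⟨Complex.I, IntermediateField.mem_adjoin_simple_self ℚ Complex.I⟩

theorem I_sq : I ^ 2 = -1 := Subtype.ext (by simp [I])

theorem isIntegral_complexI : IsIntegral ℚ Complex.I :=
  ⟨Polynomial.X ^ 2 + 1, by monicity!, by simp⟩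

theorem exists_eq_add_mul_I (z : GaussField) : ∃ x y : ℚ, z = x + y * I := by
  obtain ⟨z, hz⟩ := z
  suffices ∃ x y : ℚ, z = x + y * Complex.I by
    obtain ⟨x, y, h⟩ := this
    exact ⟨x, y, Subtype.ext (by simp [h, I])⟩
  rw [GaussField, ← IntermediateField.mem_toSubalgebra,
    IntermediateField.adjoin_simple_toSubalgebra_of_isAlgebraic isIntegral_complexI.isAlgebraic] at hz
  induction hz using Algebra.adjoin_induction with
  | mem x hx => exact ⟨0, 1, by simpa using hx⟩
  | algebraMap r => exact ⟨r, 0, by simp⟩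
  | add _ _ _ _ hx hy =>
    obtain ⟨a, b, rfl⟩ := hx
    obtain ⟨c, d, rfl⟩ := hy
    exact ⟨a + c, b + d, by push_cast; ring⟩
  | mul _ _ _ _ hx hy =>
    obtain ⟨a, b, rfl⟩ := hx
    obtain ⟨c, d, rfl⟩ := hy
    exact ⟨a * c - b * d, a * d + b * c, by
      push_cast; linear_combination (b * d : ℂ) * Complex.I_sq⟩

instance : NumberField GaussField where
  to_charZero := inferInstance
  to_finiteDimensional := IntermediateField.adjoin.finiteDimensional isIntegral_complexI

noncomputable instance : Algebra GaussianInt GaussField :=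
  (Zsqrtd.lift ⟨I, by rw [← sq, I_sq]; simp⟩ : GaussianInt →+* GaussField).toAlgebra

theorem algebraMap_apply (z : GaussianInt) :
    algebraMap GaussianInt GaussField z = z.re + z.im * I := rfl

instance : FaithfulSMul GaussianInt GaussField :=
  (faithfulSMul_iff_algebraMap_injective _ _).2
    (Zsqrtd.lift_injective _ fun n h => by nlinarith [mul_self_nonneg n])

instance : IsFractionRing GaussianInt GaussField := by
  refine IsFractionRing.of_field _ _ fun z => ?_
  obtain ⟨x, y, rfl⟩ := exists_eq_add_mul_I z
  refine ⟨⟨x.num * y.den, y.num * x.den⟩, ((x.den * y.den : ℕ) : GaussianInt), ?_⟩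
  have hx : (x.den : GaussField) ≠ 0 := by simp
  have hy : (y.den : GaussField) ≠ 0 := by simp
  rw [map_natCast, algebraMap_apply, Rat.cast_def, Rat.cast_def]
  push_cast
  field_simp

end GaussField

namespace TwinParams

open WeierstrassCurve.Affine

variable {p q σ α β : ℤ} {π : GaussianInt}
variable {K : Type*} [Field K] [DecidableEq K] [Algebra GaussianInt K]
  [IsFractionRing GaussianInt K]

/-- A point whose double is nontrivial determines the Mordell–Weil group. -/
theorem nonempty_addEquiv [NumberField K] (h : TwinParams p q σ α β π) {P : (curve K α β).Point}
    (hP : 2 • P ≠ 0) : Nonempty ((curve K α β).Point ≃+ ZMod 2 × ZMod 2 × ℤ) := by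
  have hα : (α : K) ≠ 0 := by exact_mod_cast h.α_ne_zero
  have hβ : (β : K) ≠ 0 := by exact_mod_cast h.β_ne_zero
  have hαβ : (β : K) - α ≠ 0 := by exact_mod_cast h.sub_ne_zero
  have hker := WeierstrassCurve.ofRoots.isAddKleinFour hα hβ hαβ
  have hfin : Finite (nsmulAddMonoidHom (α := (curve K α β).Point) 2).ker :=
    Nat.finite_of_card_ne_zero (by rw [hker.card_four]; norm_num)
  have hfg := WeierstrassCurve.ofRoots.fg_of_finiteIndex hα hβ hαβ
    (finiteIndex_range_two_nsmul h.exists_eq_two_nsmul_add)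
  exact nonempty_addEquiv_of_two_nsmul hfg (fun Q hQ => h.eq_zero_of_isOfFinAddOrder hQ)
    h.exists_eq_two_nsmul_add hP

/-- A solution of `q = a² + b²`, `(a + 1)² + (b + 1)² = c²` gives a rational point that is not
two-torsion. -/
theorem exists_two_nsmul_ne_zero [CharZero K] (h : TwinParams p q σ α β π) {i : K}
    (hi : i ^ 2 = -1) {a b c : ℤ} (hq : q = a ^ 2 + b ^ 2)
    (hc : (a + 1) ^ 2 + (b + 1) ^ 2 = c ^ 2) : ∃ P : (curve K α β).Point, 2 • P ≠ 0 := by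
  have hw : ((a : K) + 1) ^ 2 + (b + 1) ^ 2 = c ^ 2 := by exact_mod_cast hc
  have hqK : (q : K) = a ^ 2 + b ^ 2 := by exact_mod_cast hq
  have hpK : (p : K) = a ^ 2 + b ^ 2 - 2 := by rw [← hqK, h.q_eq]; push_cast; ring
  have hσ : (σ : K) ^ 2 = 1 := by rcases h.sign with rfl | rfl <;> norm_num
  have hq8 : q % 8 = 5 := by have := h.p_mod; have := h.q_eq; omega
  have hc0 : (c : K) ≠ 0 := by
    rw [Int.cast_ne_zero]
    rintro rfl
    obtain rfl : a = -1 := by nlinarith [sq_nonneg (a + 1), sq_nonneg (b + 1)]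
    obtain rfl : b = -1 := by nlinarith [sq_nonneg (b + 1)]
    norm_num [hq] at hq8
  have hu0 : (a : K) + b * i ≠ 0 := by
    intro h0
    have : (q : K) = 0 := by
      rw [hqK]; linear_combination ((a : K) - b * i) * h0 + (b : K) ^ 2 * hi
    exact h.prime_q.ne_zero (by exact_mod_cast this)
  have hσ0 : 1 + σ * i ≠ 0 := by
    intro h0
    have : (2 : K) = 0 := by linear_combination (1 - σ * i) * h0 + σ ^ 2 * hi - hσ
    exact two_ne_zero this
  have hP : (curve K α β).Nonsingular (-σ * (a + b * i) * (a - b * i + 1 - i))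
      ((1 + σ * i) * (a + b * i) * c) := by
    rw [h.nonsingular_iff, h.α_eq, h.β_eq]
    push_cast
    set u : K := a + b * i with hu
    set w : K := a - b * i + 1 - i with hw'
    have e1 : -(σ : K) * u * w + σ * q = -σ * (1 - i) * u := by
      rw [hqK, hu, hw']; linear_combination (σ * b ^ 2 : K) * hi
    have e2 : -(σ : K) * u * w + σ * p = -σ * (1 - i) * (u + 1 + i) := by
      rw [hpK, hu, hw']; linear_combination (σ * b ^ 2 - σ : K) * hi
    have e3 : (c : K) ^ 2 = w * (u + 1 + i) := by
      rw [← hw, hu, hw']; linear_combination ((b + 1) ^ 2 : K) * hi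
    rw [e1, e2, mul_pow, e3]
    linear_combination
      (u ^ 2 * (w * (u + 1 + i))) * ((1 + σ : K) * hi + (i ^ 2 + σ - 2 * σ * i + σ * i ^ 2) * hσ)
  exact ⟨Point.some _ _ hP, by
    rw [Ne, WeierstrassCurve.ofRoots.two_nsmul_eq_zero_iff]
    exact mul_ne_zero (mul_ne_zero hσ0 hu0) hc0⟩

end TwinParams

theorem twinCurve_baseChange (K : Type*) [Field K] [CharZero K] [Algebra ℚ K] (p q σ : ℤ) :
    (twinCurve p q σ).baseChange K =
      WeierstrassCurve.ofRoots ((σ * p : ℤ) : K) ((σ * q : ℤ) : K) := by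
  ext <;> simp [twinCurve, WeierstrassCurve.ofRoots, WeierstrassCurve.baseChange, mul_add]

theorem stmt_1 (p q : ℤ) (hp : Prime p) (hq : Prime q) (htwin : q - p = 2)
    (hmod : p % 8 = 3)
    (hsum : ∃ a b c ε δ : ℤ, (ε = 1 ∨ ε = -1) ∧ (δ = 1 ∨ δ = -1) ∧
      q = a ^ 2 + b ^ 2 ∧ (a + ε) ^ 2 + (b + δ) ^ 2 = c ^ 2)
    (σ : ℤ) (hσ : σ = 1 ∨ σ = -1) :
    Nonempty ((((twinCurve p q σ).baseChange GaussField).toAffine.Point) ≃+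
      (ZMod 2 × ZMod 2 × ℤ)) := by
  obtain ⟨a, b, c, hab, hc⟩ : ∃ a b c : ℤ, q = a ^ 2 + b ^ 2 ∧
      (a + 1) ^ 2 + (b + 1) ^ 2 = c ^ 2 := by
    obtain ⟨a, b, c, ε, δ, hε, hδ, hab, hc⟩ := hsum
    refine ⟨ε * a, δ * b, c, ?_, ?_⟩
    · rcases hε with rfl | rfl <;> rcases hδ with rfl | rfl <;> linear_combination hab
    · rcases hε with rfl | rfl <;> rcases hδ with rfl | rfl <;> linear_combination hc
  have h : TwinParams p q σ (σ * p) (σ * q) ⟨a, b⟩ :=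
    ⟨hp, hq, by omega, hmod, by have := sq_nonneg a; have := sq_nonneg b; omega, hσ, rfl, rfl,
      by rw [Zsqrtd.norm_def, hab]; ring⟩
  rw [twinCurve_baseChange]
  obtain ⟨P, hP⟩ := h.exists_two_nsmul_ne_zero GaussField.I_sq hab hc
  exact h.nonempty_addEquiv hP
end

section
/- Let p and q be twin primes with q - p = 2, let σ ∈ {+1, -1}, and let E_σ be the elliptic curve y² = x(x + σp)(x + σq). Then rank E_σ(K) ≤ 3 over the Gauss field K = ℚ(√-1); equivalently, there is no injective group homomorphism from ℤ⁴ into the Mordell–Weil group E_σ(K). -/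
theorem AddSubgroup.index_range_eq_card_ker {D : Type*} [AddCommGroup D] [Finite D] (f : D →+ D) :
    f.range.index = Nat.card f.ker := by
  have h1 := f.range.card_mul_index
  have h2 := f.ker.card_mul_index
  rw [AddSubgroup.index_ker] at h2
  have : 0 < Nat.card f.range := Nat.card_pos
  rw [← h2, mul_comm] at h1
  exact Nat.eq_of_mul_eq_mul_right this h1

/-- A finitely generated abelian group `G` with at least `2 ^ s` elements killed by `2` and with
`[G : 2G] ≤ 2 ^ (r + s)` has rank at most `r`. -/
theorem finrank_le_of_index_two_nsmul_le {G : Type*} [AddCommGroup G] [AddGroup.FG G]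
    {r s : ℕ} (h0 : (nsmulAddMonoidHom (α := G) 2).range.index ≠ 0)
    (h : (nsmulAddMonoidHom (α := G) 2).range.index ≤ 2 ^ (r + s))
    {t : Finset G} (ht : t.card = 2 ^ s) (ht' : ∀ x ∈ t, 2 • x = 0) :
    Module.finrank ℤ G ≤ r := by
  have : Module.Finite ℤ G := Module.Finite.iff_addGroup_fg.2 inferInstance
  obtain ⟨n, ι, _, p, hp, e, ⟨φ⟩⟩ := AddCommGroup.equiv_free_prod_directSum_zmod G
  set D := DirectSum ι fun i ↦ ZMod (p i ^ e i)
  have : ∀ i, NeZero (p i ^ e i) := fun i ↦ ⟨pow_ne_zero _ (hp i).ne_zero⟩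
  have : Finite D :=
    Finite.of_equiv _ (DirectSum.addEquivProd fun i ↦ ZMod (p i ^ e i)).symm.toEquiv
  have hr : Module.finrank ℤ G ≤ n := by
    let π : G →ₗ[ℤ] (Fin n →₀ ℤ) := (LinearMap.fst ℤ _ D) ∘ₗ φ.toIntLinearEquiv.toLinearMap
    have hk : Module.finrank ℤ (LinearMap.ker π) = 0 := by
      have : Finite (LinearMap.ker π) := by
        refine Finite.of_injective (β := D) (fun x ↦ (φ x.1).2) fun x y hxy ↦ ?_
        have hx : (φ x.1).1 = 0 := x.2
        have hy : (φ y.1).1 = 0 := y.2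
        exact Subtype.ext (φ.injective (Prod.ext (hx.trans hy.symm) hxy))
      rw [Module.finrank_eq_zero_iff]
      intro x
      refine ⟨Nat.card (LinearMap.ker π), by exact_mod_cast Nat.card_pos.ne', ?_⟩
      rw [Nat.cast_smul_eq_nsmul]
      exact card_nsmul_eq_zero'
    have h1 := Submodule.finrank_quotient_add_finrank (LinearMap.ker π)
    rw [π.quotKerEquivRange.finrank_eq] at h1
    have h2 := Submodule.finrank_le (LinearMap.range π)
    simp at h2
    omega
  let N : AddSubgroup D := (nsmulAddMonoidHom (α := D) 2).range
  let ψ : G →+ (Fin n → ZMod 2) × (D ⧸ N) :=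
    AddMonoidHom.prod
      (((Int.castAddHom (ZMod 2)).compLeft (Fin n)).comp
        (Finsupp.coeFnAddHom.comp ((AddMonoidHom.fst _ D).comp φ.toAddMonoidHom)))
      ((QuotientAddGroup.mk' N).comp ((AddMonoidHom.snd _ D).comp φ.toAddMonoidHom))
  have hψ : Function.Surjective ψ := by
    rintro ⟨a, b⟩
    obtain ⟨b, rfl⟩ := QuotientAddGroup.mk'_surjective N b
    refine ⟨φ.symm (Finsupp.equivFunOnFinite.symm fun i ↦ (a i).val, b), ?_⟩
    ext i <;> simp [ψ]
  have hle : (nsmulAddMonoidHom (α := G) 2).range ≤ ψ.ker := by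
    rintro _ ⟨x, rfl⟩
    rw [AddMonoidHom.mem_ker]
    ext i
    · simpa [ψ] using Or.inl (by decide)
    · simp only [ψ, nsmulAddMonoidHom_apply]
      rw [map_nsmul]
      exact (QuotientAddGroup.eq_zero_iff (N := N) (2 • (φ x).2)).2 ⟨(φ x).2, by simp⟩
  have hidx := Nat.le_of_dvd (Nat.pos_of_ne_zero h0) (AddSubgroup.index_dvd_of_le hle)
  rw [AddSubgroup.index_ker, AddMonoidHom.range_eq_top.2 hψ, AddSubgroup.card_top, Nat.card_prod,
    ← AddSubgroup.index_eq_card, AddSubgroup.index_range_eq_card_ker] at hidx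
  have hD : 2 ^ s ≤ Nat.card (nsmulAddMonoidHom (α := D) 2).ker := by
    rw [← ht, ← Nat.card_eq_finsetCard]
    have key : ∀ x ∈ t, 2 • (φ x) = 0 := fun x hx ↦ by rw [← map_nsmul, ht' x hx, map_zero]
    refine Nat.card_le_card_of_injective
      (fun x : t ↦ ⟨(φ x.1).2, congrArg Prod.snd (key x x.2)⟩) fun x y hxy ↦ ?_
    have hz : ∀ x ∈ t, (φ x).1 = 0 := fun x hx ↦ by
      have := congrArg Prod.fst (key x hx)
      simpa using this
    exact Subtype.ext (φ.injective (Prod.ext ((hz x x.2).trans (hz y y.2).symm)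
      (congrArg Subtype.val hxy)))
  have h5 : 2 ^ n * 2 ^ s ≤ 2 ^ (r + s) := by
    refine le_trans (le_trans (Nat.mul_le_mul_left _ hD) ?_) h
    simpa using hidx
  rw [← pow_add] at h5
  have := (Nat.pow_le_pow_iff_right (by norm_num)).1 h5
  omega

namespace WeierstrassCurve.Affine.Point

section

variable {K : Type*} [Field K] {W : WeierstrassCurve K}

open MvPolynomial in
theorem eval_addSubMap (x : Fin 3 → K) :
    (fun i ↦ (addSubMap W i).eval x) =
      ![x 0 ^ 2 - W.b₄ * x 0 * x 2 - W.b₆ * x 1 * x 2 - W.b₈ * x 2 ^ 2,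
        2 * x 1 * x 0 + W.b₂ * x 0 * x 2 + W.b₄ * x 1 * x 2 + W.b₆ * x 2 ^ 2,
        x 1 ^ 2 - 4 * x 0 * x 2] := by
  ext i
  fin_cases i <;> simp [addSubMap]

theorem exists_addSubMap_sym2x_eq_smul [DecidableEq K] [W.IsElliptic] (h₁ : W.a₁ = 0)
    (h₃ : W.a₃ = 0) (P Q : W.toAffine.Point) :
    ∃ c : K, c ≠ 0 ∧
      (fun i ↦ (addSubMap W i).eval (P.sym2x Q)) = c • (P + Q).sym2x (P - Q) := by
  have self_of : ∀ P : W.toAffine.Point, ∃ c : K, c ≠ 0 ∧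
      (fun i ↦ (addSubMap W i).eval (P.sym2x P)) = c • (P + P).sym2x 0 := by
    intro P
    rcases P with _ | ⟨x, y, h⟩
    · refine ⟨1, one_ne_zero, ?_⟩
      rw [eval_addSubMap]
      simp [← zero_def]
    · have e := (equation_iff _ _).1 h.1
      by_cases hy : y = W.toAffine.negY x y
      · rw [add_self_of_Y_eq hy, eval_addSubMap]
        have hy2 : 2 * y = 0 := by
          rw [negY, h₁, h₃] at hy
          linear_combination hy
        have hne := addSubMap_ne_zero (W := W) (sym2x_ne_zero (some x y h) (some x y h))
        rw [eval_addSubMap] at hne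
        have h1 : 2 * (x + x) * (x * x) + W.b₂ * (x * x) + W.b₄ * (x + x) + W.b₆ = 0 := by
          rw [h₁, h₃] at e
          simp only [b₂, b₄, b₆, h₁, h₃]
          linear_combination -4 * e + 2 * y * hy2
        have h2 : (x + x) ^ 2 - 4 * (x * x) = 0 := by ring
        refine ⟨(x * x) ^ 2 - W.b₄ * (x * x) - W.b₆ * (x + x) - W.b₈, fun h0 ↦ hne ?_, ?_⟩
        · ext i
          fin_cases i <;> simp [h0, h1, h2]
        · ext i
          fin_cases i <;> simp [h1, h2]
      · rw [add_self_of_Y_ne hy, eval_addSubMap]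
        have hy2 : 2 * y ≠ 0 := by
          rw [negY, h₁, h₃] at hy
          exact fun h0 ↦ hy (by linear_combination h0)
        refine ⟨(2 * y) ^ 2, pow_ne_zero _ hy2, ?_⟩
        rw [h₁, h₃] at e
        have hd : y - W.toAffine.negY x y = 2 * y := by rw [negY, h₁, h₃]; ring
        have hy0 := right_ne_zero_of_mul hy2
        have h20 := left_ne_zero_of_mul hy2
        simp only [slope_of_Y_ne rfl hy, hd]
        ext i
        fin_cases i
        · simp [addX, b₂, b₄, b₆, b₈, h₁, h₃]
          field_simp
          linear_combination (4 * W.a₂ + 8 * x) * e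
        · simp [b₂, b₄, b₆, b₈, h₁, h₃]
          linear_combination -4 * e
        · simp
          ring
  by_cases h0 : P = Q
  · subst h0
    simpa using self_of P
  by_cases h0' : P = -Q
  · subst h0'
    obtain ⟨c, hc, H⟩ := self_of (-Q)
    refine ⟨c, hc, ?_⟩
    rw [sym2x_neg_right] at H
    rw [neg_add_cancel, sym2x_comm 0, H, sub_eq_add_neg]
  rcases P with _ | ⟨x₁, y₁, e₁⟩
  · refine ⟨1, one_ne_zero, ?_⟩
    rcases Q with _ | ⟨x₂, y₂, e₂⟩
    · exact absurd rfl h0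
    rw [← zero_def, zero_add, zero_sub, sym2x_neg_right, eval_addSubMap]
    ext i
    fin_cases i <;> simp <;> ring
  rcases Q with _ | ⟨x₂, y₂, e₂⟩
  · refine ⟨1, one_ne_zero, ?_⟩
    rw [← zero_def, add_zero, sub_zero, eval_addSubMap]
    ext i
    fin_cases i <;> simp <;> ring
  have hx : x₁ ≠ x₂ := fun hx ↦ by
    rcases X_eq_iff.1 hx with h | h
    exacts [h0 h, h0' h]
  have hd : x₁ - x₂ ≠ 0 := sub_ne_zero.2 hx
  refine ⟨(x₁ - x₂) ^ 2, pow_ne_zero _ hd, ?_⟩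
  rw [eval_addSubMap, sub_eq_add_neg (some x₁ y₁ e₁), neg_some, add_of_X_ne hx, add_of_X_ne hx]
  simp only [slope_of_X_ne hx]
  have E₁ := (equation_iff _ _).1 e₁.1
  have E₂ := (equation_iff _ _).1 e₂.1
  rw [h₁, h₃] at E₁ E₂
  ext i
  fin_cases i
  · simp [addX, negY, b₂, b₄, b₆, b₈, h₁, h₃]
    field_simp
    linear_combination
      -(y₁ ^ 2 - y₂ ^ 2 + (x₁ ^ 3 + W.a₂ * x₁ ^ 2 + W.a₄ * x₁ + W.a₆) -
        (x₂ ^ 3 + W.a₂ * x₂ ^ 2 + W.a₄ * x₂ + W.a₆)) * (E₁ - E₂) +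
        2 * (x₁ - x₂) ^ 2 * (W.a₂ + x₁ + x₂) * (E₁ + E₂)
  · simp [addX, negY, b₂, b₄, b₆, b₈, h₁, h₃]
    field_simp
    linear_combination -2 * E₁ - 2 * E₂
  · simp
    ring

end

section

open Height

variable {K : Type*} [Field K] [NumberField K] {W : WeierstrassCurve K}

theorem logHeight_xRep_northcott :
    Northcott fun P : W.toAffine.Point ↦ logHeight P.xRep where
  finite_le b := by
    refine Set.Finite.of_finite_fibers xRep ?_ fun v _ ↦ ?_
    · refine (((Northcott.finite_le (h := logHeight₁ (K := K)) b).image fun x ↦ ![x, 1]).union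
        (Set.finite_singleton ![1, 0])).subset ?_
      rintro _ ⟨P, hP, rfl⟩
      rcases P with _ | ⟨x, y, h⟩
      · exact Or.inr rfl
      · exact Or.inl ⟨x, by simpa [logHeight₁_eq_logHeight] using hP, rfl⟩
    · by_cases hv : ∃ P : W.toAffine.Point, P.xRep = v
      · obtain ⟨P, rfl⟩ := hv
        refine (Set.toFinite {P, -P}).subset fun Q hQ ↦ ?_
        exact eq_or_eq_neg_of_xRep_eq_xRep hQ.2
      · exact Set.finite_empty.subset fun Q hQ ↦ hv ⟨Q, hQ.2⟩

theorem fg_of_finiteIndex [DecidableEq K] [W.IsElliptic] (h₁ : W.a₁ = 0) (h₃ : W.a₃ = 0)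
    (h : (nsmulAddMonoidHom (α := W.toAffine.Point) 2).range.FiniteIndex) :
    AddGroup.FG W.toAffine.Point := by
  obtain ⟨C₁, hC₁⟩ := abs_logHeight_addSubMap_sub_two_mul_logHeight_le W
  obtain ⟨C₂, hC₂⟩ := abs_logHeight_sym2_sub_le K
  have hsym : ∀ P Q : W.toAffine.Point,
      |logHeight (P.sym2x Q) - (logHeight P.xRep + logHeight Q.xRep)| ≤ C₂ := by
    intro P Q
    have := @hC₂ (P.xRep 0) (P.xRep 1) (Q.xRep 0) (Q.xRep 1)
    have hv : ∀ R : W.toAffine.Point, ![R.xRep 0, R.xRep 1] = R.xRep := fun R ↦ by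
      ext i; fin_cases i <;> rfl
    rw [hv, hv] at this
    exact this P.xRep_ne_zero Q.xRep_ne_zero
  have := logHeight_xRep_northcott (W := W)
  refine AddCommGroup.fg_of_descent' (h := fun P : W.toAffine.Point ↦ logHeight P.xRep)
    (C := C₁ + 3 * C₂) h (fun P ↦ logHeight_nonneg _) fun P Q ↦ ?_
  obtain ⟨c, hc, H⟩ := exists_addSubMap_sym2x_eq_smul h₁ h₃ P Q
  have a := hC₁ (P.sym2x Q)
  rw [H, logHeight_smul_eq_logHeight _ hc] at a
  have b := hsym P Q
  have d := hsym (P + Q) (P - Q)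
  rw [abs_le] at *
  constructor <;> linarith

end

end WeierstrassCurve.Affine.Point

namespace WeierstrassCurve.Affine.Point

variable {F : Type*} [Field F] [DecidableEq F] {W : WeierstrassCurve F}

/-- The `x - e` component of the complete `2`-descent map attached to a root `e` of the cubic. -/
def descentMap (e : F) : W.toAffine.Point → F
  | zero => 1
  | some x _ _ => if x = e then 3 * e ^ 2 + 2 * W.a₂ * e + W.a₄ else x - e

@[simp]
theorem descentMap_zero (e : F) : descentMap e (0 : W.toAffine.Point) = 1 := rfl

theorem descentMap_some (e : F) {x y : F} (h : W.toAffine.Nonsingular x y) :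
    descentMap e (some x y h) = if x = e then 3 * e ^ 2 + 2 * W.a₂ * e + W.a₄ else x - e := rfl

theorem descentMap_ne_zero {e : F} (he : 3 * e ^ 2 + 2 * W.a₂ * e + W.a₄ ≠ 0)
    (P : W.toAffine.Point) : descentMap e P ≠ 0 := by
  rcases P with _ | ⟨x, y, h⟩
  · exact one_ne_zero
  · rw [descentMap_some]
    split_ifs with hx
    · exact he
    · exact sub_ne_zero.2 hx

theorem isSquare_descentMap_mul (h₁ : W.a₁ = 0) (h₃ : W.a₃ = 0) {e : F}
    (hr : e ^ 3 + W.a₂ * e ^ 2 + W.a₄ * e + W.a₆ = 0)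
    (he : 3 * e ^ 2 + 2 * W.a₂ * e + W.a₄ ≠ 0) (P Q : W.toAffine.Point) :
    IsSquare (descentMap e P * descentMap e Q * descentMap e (P + Q)) := by
  rcases P with _ | ⟨x₁, y₁, hP⟩
  · rw [← zero_def, zero_add]
    exact ⟨descentMap e Q, by simp⟩
  rcases Q with _ | ⟨x₂, y₂, hQ⟩
  · rw [← zero_def, add_zero]
    exact ⟨_, by rw [descentMap_zero, mul_one]⟩
  by_cases hxy : x₁ = x₂ ∧ y₁ = W.toAffine.negY x₂ y₂
  · rw [add_of_Y_eq hxy.1 hxy.2]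
    exact ⟨descentMap e (some x₁ y₁ hP), by simp [descentMap_some, hxy.1]⟩
  rw [add_some hxy]
  have hs := addPolynomial_slope hP.1 hQ.1 hxy
  have hd := derivative_addPolynomial_slope hP.1 hQ.1 hxy
  simp only [descentMap_some]
  generalize W.toAffine.slope x₁ x₂ y₁ y₂ = ℓ at hs hd ⊢
  generalize W.toAffine.addX x₁ x₂ ℓ = x₃ at hs hd ⊢
  replace hs := congrArg (Polynomial.eval e) hs
  replace hd := congrArg (Polynomial.eval e) hd
  simp [addPolynomial_eq, Cubic.toPoly, h₁, h₃, Polynomial.derivative_pow] at hs hd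
  have key : (x₁ - e) * (x₂ - e) * (x₃ - e) = (ℓ * (e - x₁) + y₁) ^ 2 := by
    linear_combination -hs - hr
  have key' : (x₁ - e) * (x₂ - e) + (x₁ - e) * (x₃ - e) + (x₂ - e) * (x₃ - e) +
      2 * ℓ * (ℓ * (e - x₁) + y₁) = 3 * e ^ 2 + 2 * W.a₂ * e + W.a₄ := by
    linear_combination hd
  generalize 3 * e ^ 2 + 2 * W.a₂ * e + W.a₄ = d at *
  have hL : (x₁ = e ∨ x₂ = e ∨ x₃ = e) → ℓ * (e - x₁) + y₁ = 0 := by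
    intro h
    refine pow_eq_zero_iff two_ne_zero |>.1 (key.symm.trans ?_)
    rcases h with h | h | h <;> simp [h]
  generalize ℓ * (e - x₁) + y₁ = L at *
  simp only [← sub_eq_zero (b := e)] at *
  generalize x₁ - e = X₁ at *
  generalize x₂ - e = X₂ at *
  generalize x₃ - e = X₃ at *
  clear hs hd
  by_cases h1 : X₁ = 0
  · have := hL (.inl h1)
    subst h1 this
    simp at key'
    have hne : X₂ ≠ 0 ∧ X₃ ≠ 0 := by rw [← mul_ne_zero_iff, key']; exact he
    exact ⟨d, by simp [hne.1, hne.2, mul_assoc, key']⟩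
  by_cases h2 : X₂ = 0
  · have := hL (.inr <| .inl h2)
    subst h2 this
    simp at key'
    have hne : X₁ ≠ 0 ∧ X₃ ≠ 0 := by rw [← mul_ne_zero_iff, key']; exact he
    exact ⟨d, by simp [hne.1, hne.2]; linear_combination d * key'⟩
  by_cases h3 : X₃ = 0
  · have := hL (.inr <| .inr h3)
    subst h3 this
    simp at key'
    have hne : X₁ ≠ 0 ∧ X₂ ≠ 0 := by rw [← mul_ne_zero_iff, key']; exact he
    exact ⟨d, by simp [hne.1, hne.2, key']⟩
  · exact ⟨L, by simp [h1, h2, h3, key, sq]⟩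

theorem exists_two_nsmul_eq [NeZero (2 : F)] (h₁ : W.a₁ = 0) (h₃ : W.a₃ = 0) {e₁ e₂ e₃ : F}
    (h₂ : W.a₂ = -(e₁ + e₂ + e₃)) (h₄ : W.a₄ = e₁ * e₂ + e₁ * e₃ + e₂ * e₃)
    (h₆ : W.a₆ = -(e₁ * e₂ * e₃)) (h₁₂ : e₁ ≠ e₂) (h₁₃ : e₁ ≠ e₃) (h₂₃ : e₂ ≠ e₃)
    {x y : F} (h : W.toAffine.Nonsingular x y)
    (hs₁ : IsSquare (x - e₁)) (hs₂ : IsSquare (x - e₂)) (hs₃ : IsSquare (x - e₃)) :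
    ∃ Q : W.toAffine.Point, 2 • Q = some x y h := by
  obtain ⟨z₁, hz₁⟩ := hs₁
  obtain ⟨z₂, hz₂⟩ := hs₂
  obtain ⟨z₃, hz₃⟩ := hs₃
  have e := (equation_iff _ _).1 h.1
  simp only [h₁, h₂, h₃, h₄, h₆, zero_mul, add_zero] at e
  have hyz : y ^ 2 = (z₁ * z₂ * z₃) ^ 2 := by
    rw [e]
    calc _ = (x - e₁) * (x - e₂) * (x - e₃) := by ring
      _ = _ := by rw [hz₁, hz₂, hz₃]; ring
  wlog hyz' : y = z₁ * z₂ * z₃ generalizing z₁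
  · exact this (-z₁) (by rw [hz₁]; ring) (by rw [hyz]; ring)
      (by rcases sq_eq_sq_iff_eq_or_eq_neg.1 hyz with h | h
          · exact absurd h hyz'
          · rw [h]; ring)
  have n₁₂ : z₁ + z₂ ≠ 0 := fun h ↦ h₁₂ <| by
    linear_combination hz₂ - hz₁ - (z₁ - z₂) * h
  have n₁₃ : z₁ + z₃ ≠ 0 := fun h ↦ h₁₃ <| by
    linear_combination hz₃ - hz₁ - (z₁ - z₃) * h
  have n₂₃ : z₂ + z₃ ≠ 0 := fun h ↦ h₂₃ <| by
    linear_combination hz₃ - hz₂ - (z₂ - z₃) * h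
  obtain rfl : e₁ = x - z₁ * z₁ := by linear_combination -hz₁
  obtain rfl : e₂ = x - z₂ * z₂ := by linear_combination -hz₂
  obtain rfl : e₃ = x - z₃ * z₃ := by linear_combination -hz₃
  set X := x + z₁ * z₂ + z₁ * z₃ + z₂ * z₃ with hX
  set Y := (z₁ + z₂) * (z₁ + z₃) * (z₂ + z₃) with hY
  have hY0 : Y ≠ 0 := by simp [hY, n₁₂, n₁₃, n₂₃]
  have hYn : Y ≠ W.toAffine.negY X Y := by
    simp only [negY, h₁, h₃]
    intro h
    have : 2 * Y = 0 := by linear_combination h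
    exact hY0 ((mul_eq_zero.1 this).resolve_left two_ne_zero)
  have hXY : W.toAffine.Nonsingular X Y := by
    rw [nonsingular_iff]
    refine ⟨?_, .inr hYn⟩
    rw [equation_iff, h₁, h₂, h₃, h₄, h₆]
    ring
  have hsl : W.toAffine.slope X X Y Y = z₁ + z₂ + z₃ := by
    rw [slope_of_Y_ne rfl hYn, div_eq_iff (sub_ne_zero.2 hYn), negY, h₁, h₂, h₃, h₄]
    ring
  refine ⟨some X Y hXY, ?_⟩
  rw [two_nsmul, add_self_of_Y_ne hYn, some.injEq]
  simp only [hsl, addX, addY, negAddY, negY, h₁, h₂, h₃]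
  constructor
  · ring
  · rw [hyz']; ring

end WeierstrassCurve.Affine.Point

theorem Rat.isSquare_of_even_padicValRat {x : ℚ} (hx : 0 < x)
    (h : ∀ ℓ : ℕ, ℓ.Prime → Even (padicValRat ℓ x)) : IsSquare x := by
  have hd : (x.den : ℚ) ≠ 0 := Nat.cast_ne_zero.2 x.den_nz
  obtain ⟨n, hn⟩ : ∃ n : ℕ, (n : ℚ) = x * x.den ^ 2 := by
    refine ⟨x.num.natAbs * x.den, ?_⟩
    rw [sq, ← mul_assoc, Rat.mul_den_eq_num, Nat.cast_mul, Nat.cast_natAbs,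
      abs_of_nonneg (Rat.num_nonneg.2 hx.le)]
  have hn0 : n ≠ 0 := by
    rw [← Nat.cast_ne_zero (R := ℚ), hn]
    positivity
  obtain ⟨a, b, hab, ha⟩ := Nat.sq_mul_squarefree n
  suffices a = 1 by
    refine ⟨b / x.den, ?_⟩
    rw [this, mul_one] at hab
    rw [← hab, Nat.cast_pow] at hn
    field_simp
    exact hn.symm
  by_contra ha1
  obtain ⟨ℓ, hℓ, hdvd⟩ := Nat.exists_prime_and_dvd ha1
  have := Fact.mk hℓ
  have ha0 : a ≠ 0 := ha.ne_zero
  have hb0 : b ≠ 0 := by rintro rfl; simp at hab; exact hn0 hab.symm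
  have hv : padicValNat ℓ a = 1 := by
    have h1 := one_le_padicValNat_of_dvd ha0 hdvd
    have h2 := (Nat.squarefree_iff_factorization_le_one ha0).1 ha ℓ
    rw [Nat.factorization_def _ hℓ] at h2
    omega
  have e1 : padicValRat ℓ (n : ℚ) = padicValRat ℓ x + 2 * padicValRat ℓ (x.den : ℚ) := by
    rw [hn, padicValRat.mul hx.ne' (pow_ne_zero _ hd), padicValRat.pow]
    rfl
  have e2 : padicValRat ℓ (n : ℚ) = 2 * padicValNat ℓ b + 1 := by
    rw [← hab, padicValRat.of_nat, padicValNat.mul (pow_ne_zero _ hb0) ha0, padicValNat.pow, hv]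
    push_cast
    rfl
  obtain ⟨m, hm⟩ := h ℓ hℓ
  omega

theorem padicValRat_intCast_nonneg (ℓ : ℕ) (d : ℤ) : 0 ≤ padicValRat ℓ (d : ℚ) := by
  rw [padicValRat.of_int]
  positivity

theorem even_padicValRat_of_mul_eq_sq (ℓ : ℕ) [Fact ℓ.Prime] {A B C y : ℚ} (hA : A ≠ 0)
    (hB : B ≠ 0) (hC : C ≠ 0) (h : y ^ 2 = A * B * C) :
    Even (padicValRat ℓ A + padicValRat ℓ B + padicValRat ℓ C) := by
  refine ⟨padicValRat ℓ y, ?_⟩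
  rw [← padicValRat.mul hA hB, ← padicValRat.mul (mul_ne_zero hA hB) hC, ← h, padicValRat.pow]
  push_cast
  ring

theorem dvd_of_odd_padicValRat (ℓ : ℕ) [hℓ : Fact ℓ.Prime] {A y : ℚ} {d d' : ℤ} (hd : d ≠ 0)
    (hA : A ≠ 0) (hB : A + d ≠ 0) (hC : A + d' ≠ 0) (h : y ^ 2 = A * (A + d) * (A + d'))
    (h1 : Odd (padicValRat ℓ A)) (h2 : Odd (padicValRat ℓ (A + d))) : (ℓ : ℤ) ∣ d := by
  have hs := even_padicValRat_of_mul_eq_sq ℓ hA hB hC h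
  have hlt : ∀ {B C : ℚ}, B ≠ 0 → B + C ≠ 0 → padicValRat ℓ B < 0 → 0 ≤ padicValRat ℓ C →
      padicValRat ℓ (B + C) = padicValRat ℓ B := by
    intro B C hB hBC hneg hnn
    rcases eq_or_ne C 0 with rfl | hC
    · rw [add_zero]
    · exact padicValRat.add_eq_of_lt hBC hB hC (hneg.trans_le hnn)
  have hApos : 0 < padicValRat ℓ A := by
    by_contra hneg
    have hneg : padicValRat ℓ A < 0 := by
      obtain ⟨m, hm⟩ := h1
      omega
    rw [hlt hA hB hneg (padicValRat_intCast_nonneg _ _),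
      hlt hA hC hneg (padicValRat_intCast_nonneg _ _)] at hs
    obtain ⟨m, hm⟩ := h1
    obtain ⟨k, hk⟩ := hs
    omega
  have hBpos : 0 < padicValRat ℓ (A + d) := by
    have := padicValRat.min_le_padicValRat_add (p := ℓ) hB
    have h0 := padicValRat_intCast_nonneg ℓ d
    obtain ⟨m, hm⟩ := h2
    omega
  have hdq : (d : ℚ) ≠ 0 := Int.cast_ne_zero.2 hd
  have hv : 0 < padicValRat ℓ (d : ℚ) := by
    have e : (d : ℚ) = (A + d) + -A := by ring
    have := padicValRat.min_le_padicValRat_add (p := ℓ) (q := A + d) (r := -A) (by rwa [← e])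
    rw [← e, padicValRat.neg] at this
    exact (lt_min hBpos hApos).trans_le this
  by_contra hdvd
  rw [padicValRat.of_int, padicValInt.eq_zero_of_not_dvd hdvd] at hv
  exact lt_irrefl _ hv

theorem Nat.Prime.not_eq_sq_add_sq_rat {p : ℕ} (hp : p.Prime) (h : p % 4 = 3) (u v : ℚ) :
    (p : ℚ) ≠ u ^ 2 + v ^ 2 := by
  intro huv
  have := Fact.mk hp
  have key : (u.den * v.den) ^ 2 * p = (u.num.natAbs * v.den) ^ 2 + (v.num.natAbs * u.den) ^ 2 := by
    rw [← Nat.cast_inj (R := ℚ)]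
    push_cast
    simp only [mul_pow, Nat.cast_natAbs, Int.cast_abs, sq_abs]
    rw [huv, ← Rat.mul_den_eq_num u, ← Rat.mul_den_eq_num v]
    ring
  have hne : u.den * v.den ≠ 0 := mul_ne_zero u.den_nz v.den_nz
  have := Nat.eq_sq_add_sq_iff.1 ⟨_, _, key⟩ p
    (Nat.mem_primeFactors.2 ⟨hp, dvd_mul_left _ _, mul_ne_zero (pow_ne_zero _ hne) hp.ne_zero⟩) h
  rw [padicValNat.mul (pow_ne_zero _ hne) hp.ne_zero, padicValNat.pow, padicValNat_self] at this
  obtain ⟨m, hm⟩ := this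
  omega
namespace WeierstrassCurve.Affine.Point

/-- The composite of a component of the complete `2`-descent map with a quadratic character. -/
def descentHom {F : Type*} [Field F] [DecidableEq F] {W : WeierstrassCurve F} (χ : F → ZMod 2)
    (hχ : ∀ x y, x ≠ 0 → y ≠ 0 → χ (x * y) = χ x + χ y) (h₁ : W.a₁ = 0) (h₃ : W.a₃ = 0) {e : F}
    (hr : e ^ 3 + W.a₂ * e ^ 2 + W.a₄ * e + W.a₆ = 0)
    (he : 3 * e ^ 2 + 2 * W.a₂ * e + W.a₄ ≠ 0) : W.toAffine.Point →+ ZMod 2 :=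
  AddMonoidHom.mk' (fun P ↦ χ (descentMap e P)) fun P Q ↦ by
    have n := descentMap_ne_zero he (W := W)
    obtain ⟨r, hsq⟩ := isSquare_descentMap_mul h₁ h₃ hr he P Q
    have hr0 : r ≠ 0 := by
      rintro rfl
      rw [mul_zero] at hsq
      exact mul_ne_zero (mul_ne_zero (n P) (n Q)) (n (P + Q)) hsq
    have := congrArg χ hsq
    rw [hχ _ _ (mul_ne_zero (n P) (n Q)) (n _), hχ _ _ (n P) (n Q), hχ _ _ hr0 hr0] at this
    revert this
    generalize χ (descentMap e P) = a
    generalize χ (descentMap e Q) = b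
    generalize χ (descentMap e (P + Q)) = c
    generalize χ r = d
    decide +revert

end WeierstrassCurve.Affine.Point

theorem Int.even_of_even_add_of_pairwise {a b c : ℤ} (h : Even (a + b + c))
    (hab : Odd a → ¬ Odd b) (hac : Odd a → ¬ Odd c) (hbc : Odd b → ¬ Odd c) :
    Even a ∧ Even b ∧ Even c := by
  simp only [Int.even_iff, Int.odd_iff] at *
  omega

/-- The parity of the `ℓ`-adic valuation. -/
def padicParity (ℓ : ℕ) (x : ℚ) : ZMod 2 := (padicValRat ℓ x : ZMod 2)

theorem padicParity_mul (ℓ : ℕ) [Fact ℓ.Prime] (x y : ℚ) (hx : x ≠ 0) (hy : y ≠ 0) :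
    padicParity ℓ (x * y) = padicParity ℓ x + padicParity ℓ y := by
  simp [padicParity, padicValRat.mul hx hy]

theorem padicParity_eq_zero_iff {ℓ : ℕ} {x : ℚ} :
    padicParity ℓ x = 0 ↔ Even (padicValRat ℓ x) := by
  rw [padicParity, ZMod.intCast_eq_zero_iff_even]

/-- The sign of a rational number as an element of `ZMod 2`. -/
def signParity (x : ℚ) : ZMod 2 := if x < 0 then 1 else 0

theorem signParity_mul (x y : ℚ) (hx : x ≠ 0) (hy : y ≠ 0) :
    signParity (x * y) = signParity x + signParity y := by
  rcases hx.lt_or_gt with hx | hx <;> rcases hy.lt_or_gt with hy | hy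
  · simp [signParity, hx, hy, (mul_pos_of_neg_of_neg hx hy).not_gt]
    rfl
  · simp [signParity, hx, hy.not_gt, mul_neg_of_neg_of_pos hx hy]
  · simp [signParity, hx.not_gt, hy, mul_neg_of_pos_of_neg hx hy]
  · simp [signParity, hx.not_gt, hy.not_gt, (mul_pos hx hy).not_gt]

theorem signParity_eq_zero_iff {x : ℚ} : signParity x = 0 ↔ 0 ≤ x := by
  simp [signParity]

namespace twinCurve

open WeierstrassCurve.Affine WeierstrassCurve.Affine.Point

section

variable {p q : ℕ} {σ : ℤ}

theorem root_zero : (0 : ℚ) ^ 3 + (twinCurve p q σ).a₂ * 0 ^ 2 + (twinCurve p q σ).a₄ * 0 +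
    (twinCurve p q σ).a₆ = 0 := by
  simp [twinCurve]

theorem root_left : (-(σ * p) : ℚ) ^ 3 + (twinCurve p q σ).a₂ * (-(σ * p)) ^ 2 +
    (twinCurve p q σ).a₄ * (-(σ * p)) + (twinCurve p q σ).a₆ = 0 := by
  simp only [twinCurve, Int.cast_natCast]
  ring

theorem deriv_zero_ne_zero (hp : p ≠ 0) (hq : q ≠ 0) (hσ : σ ≠ 0) :
    3 * (0 : ℚ) ^ 2 + 2 * (twinCurve p q σ).a₂ * 0 + (twinCurve p q σ).a₄ ≠ 0 := by
  simp [twinCurve, hp, hq, hσ]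

theorem deriv_left_ne_zero (hp : p ≠ 0) (hpq : p ≠ q) (hσ : σ ≠ 0) :
    3 * (-(σ * p) : ℚ) ^ 2 + 2 * (twinCurve p q σ).a₂ * (-(σ * p)) + (twinCurve p q σ).a₄ ≠ 0 := by
  have : 3 * (-(σ * p) : ℚ) ^ 2 + 2 * (twinCurve p q σ).a₂ * (-(σ * p)) + (twinCurve p q σ).a₄ =
      (σ : ℚ) ^ 2 * p * (p - q) := by
    simp only [twinCurve, Int.cast_natCast]
    ring
  rw [this]
  simp [hp, hσ, sub_eq_zero, hpq]

variable [hp : Fact p.Prime] [hq : Fact q.Prime]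

/-- The descent homomorphism of `twinCurve p q σ`: its components are the sign of `x + σp`, the
parities of the valuations of `x` at `p` and at `q`, and that of `x + σp` at `2`. -/
def selmerHom (hpq : p ≠ q) (hσ : σ ≠ 0) :
    (twinCurve p q σ).toAffine.Point →+ ZMod 2 × ZMod 2 × ZMod 2 × ZMod 2 :=
  have hp0 := hp.1.ne_zero
  have hq0 := hq.1.ne_zero
  (descentHom signParity signParity_mul rfl rfl root_left (deriv_left_ne_zero hp0 hpq hσ)).prod <|
  (descentHom (padicParity p) (padicParity_mul p) rfl rfl root_zero
    (deriv_zero_ne_zero hp0 hq0 hσ)).prod <|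
  (descentHom (padicParity q) (padicParity_mul q) rfl rfl root_zero
    (deriv_zero_ne_zero hp0 hq0 hσ)).prod <|
  descentHom (padicParity 2) (padicParity_mul 2) rfl rfl root_left (deriv_left_ne_zero hp0 hpq hσ)

theorem selmerHom_apply (hpq : p ≠ q) (hσ : σ ≠ 0) (P : (twinCurve p q σ).toAffine.Point) :
    selmerHom hpq hσ P = (signParity (descentMap (-(σ * p)) P), padicParity p (descentMap 0 P),
      padicParity q (descentMap 0 P), padicParity 2 (descentMap (-(σ * p)) P)) :=
  rfl

omit hp hq in
theorem equation_iff {x y : ℚ} : (twinCurve p q σ).toAffine.Equation x y ↔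
    y ^ 2 = x * (x + σ * p) * (x + σ * q) := by
  rw [WeierstrassCurve.Affine.equation_iff]
  simp only [twinCurve, Int.cast_natCast, zero_mul, add_zero]
  ring_nf

/-- A point with even valuations at `p`, `q`, `2` is not `2`-torsion, and `x`, `x + σp`, `x + σq`
are then squares up to sign. -/
theorem even_padicValRat (hpq : q = p + 2) (hσ : σ = 1 ∨ σ = -1) {x y : ℚ}
    (h : (twinCurve p q σ).toAffine.Nonsingular x y)
    (h₁ : padicParity p (descentMap 0 (some x y h)) = 0)
    (h₂ : padicParity q (descentMap 0 (some x y h)) = 0)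
    (h₃ : padicParity 2 (descentMap (-(σ * p)) (some x y h)) = 0) :
    (x ≠ 0 ∧ x + σ * p ≠ 0 ∧ x + σ * q ≠ 0) ∧ ∀ ℓ : ℕ, ℓ.Prime →
      Even (padicValRat ℓ x) ∧ Even (padicValRat ℓ (x + σ * p)) ∧
        Even (padicValRat ℓ (x + σ * q)) := by
  have hp0 : (p : ℚ) ≠ 0 := Nat.cast_ne_zero.2 hp.1.ne_zero
  have hq0 : (q : ℚ) ≠ 0 := Nat.cast_ne_zero.2 hq.1.ne_zero
  have hne : p ≠ q := by omega
  have hσ0 : σ ≠ 0 := by rcases hσ with rfl | rfl <;> simp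
  have hσq : (σ : ℚ) ≠ 0 := Int.cast_ne_zero.2 hσ0
  have hσv : ∀ ℓ : ℕ, ∀ z : ℚ, padicValRat ℓ (σ * z) = padicValRat ℓ z := by
    rcases hσ with rfl | rfl <;> simp
  rw [padicParity_eq_zero_iff] at h₁ h₂ h₃
  have hx : x ≠ 0 := by
    rintro rfl
    have : descentMap 0 (some 0 y h) = (σ * p) * (σ * q) := by
      rw [descentMap_some, if_pos rfl]
      simp [twinCurve]
    rw [this, padicValRat.mul (mul_ne_zero hσq hp0) (mul_ne_zero hσq hq0), hσv, hσv,
      padicValRat.self hp.1.one_lt, padicValRat.of_nat, padicValNat_primes hne] at h₁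
    revert h₁
    decide
  rw [descentMap_some, if_neg hx, sub_zero] at h₁ h₂
  have hxp : x + σ * p ≠ 0 := by
    intro h0
    rw [eq_neg_of_add_eq_zero_left h0, padicValRat.neg, hσv, padicValRat.self hp.1.one_lt] at h₁
    exact Int.not_even_one h₁
  have hxq : x + σ * q ≠ 0 := by
    intro h0
    rw [eq_neg_of_add_eq_zero_left h0, padicValRat.neg, hσv, padicValRat.self hq.1.one_lt] at h₂
    exact Int.not_even_one h₂
  refine ⟨⟨hx, hxp, hxq⟩, fun ℓ hℓ ↦ ?_⟩
  rw [descentMap_some, if_neg (fun h0 ↦ hxp (by rw [h0]; ring)), sub_neg_eq_add] at h₃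
  have := Fact.mk hℓ
  have e := equation_iff.1 h.1
  have hs := even_padicValRat_of_mul_eq_sq ℓ hx hxp hxq e
  have dvd_unit : ∀ n : ℕ, n.Prime → (ℓ : ℤ) ∣ σ * n → ℓ = n := by
    intro n hn hd
    rw [← (Nat.prime_dvd_prime_iff_eq hℓ hn), ← Int.natCast_dvd_natCast]
    rcases hσ with rfl | rfl <;> simpa using hd
  have d₁ : Odd (padicValRat ℓ x) → Odd (padicValRat ℓ (x + σ * p)) → ℓ = p := fun o₁ o₂ ↦
    dvd_unit p hp.1 <| dvd_of_odd_padicValRat ℓ (A := x) (y := y) (d' := σ * q)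
      (mul_ne_zero hσ0 (by simpa using hp0)) hx (by simpa) (by simpa) (by simpa) o₁ (by simpa)
  have d₂ : Odd (padicValRat ℓ x) → Odd (padicValRat ℓ (x + σ * q)) → ℓ = q := fun o₁ o₂ ↦
    dvd_unit q hq.1 <| dvd_of_odd_padicValRat ℓ (A := x) (y := y) (d' := σ * p)
      (mul_ne_zero hσ0 (by simpa using hq0)) hx (by simpa) (by simpa)
      (by simp [e]; ring) o₁ (by simpa)
  have d₃ : Odd (padicValRat ℓ (x + σ * p)) → Odd (padicValRat ℓ (x + σ * q)) → ℓ = 2 := by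
    intro o₁ o₂
    have e₁ : x + σ * p + ((σ * (2 : ℕ) : ℤ) : ℚ) = x + σ * q := by
      rw [hpq]; push_cast; ring
    have e₂ : x + σ * p + ((-(σ * p) : ℤ) : ℚ) = x := by push_cast; ring
    refine dvd_unit 2 Nat.prime_two <| dvd_of_odd_padicValRat ℓ (A := x + σ * p) (y := y)
      (d' := -(σ * p)) (mul_ne_zero hσ0 (by simp)) hxp ?_ ?_ ?_ o₁ ?_
    · rwa [e₁]
    · rwa [e₂]
    · rw [e₁, e₂, e]; ring
    · rwa [e₁]
  rw [← Int.not_odd_iff_even] at h₁ h₂ h₃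
  exact Int.even_of_even_add_of_pairwise hs (fun o o' ↦ h₁ (d₁ o o' ▸ o))
    (fun o o' ↦ h₂ (d₂ o o' ▸ o)) (fun o o' ↦ h₃ (d₃ o o' ▸ o))

theorem ker_selmerHom_le (hpq : q = p + 2) (hσ : σ = 1 ∨ σ = -1) (hne : p ≠ q) (hσ0 : σ ≠ 0) :
    (selmerHom (σ := σ) hne hσ0).ker ≤
      (nsmulAddMonoidHom (α := (twinCurve p q σ).toAffine.Point) 2).range := by
  rintro (_ | ⟨x, y, h⟩) hP
  · exact zero_mem _
  rw [AddMonoidHom.mem_ker, selmerHom_apply] at hP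
  simp only [Prod.mk_eq_zero] at hP
  obtain ⟨h₀, h₁, h₂, h₃⟩ := hP
  obtain ⟨⟨hx, hxp, hxq⟩, hev⟩ := even_padicValRat hpq hσ h h₁ h₂ h₃
  rw [descentMap_some, if_neg (fun h0 ↦ hxp (by rw [h0]; ring)), sub_neg_eq_add,
    signParity_eq_zero_iff] at h₀
  replace h₀ := lt_of_le_of_ne h₀ hxp.symm
  have e := equation_iff.1 h.1
  have hq' : (q : ℚ) = p + 2 := by rw [hpq]; push_cast; rfl
  have hy : 0 < y ^ 2 := by
    refine lt_of_le_of_ne (sq_nonneg y) (Ne.symm ?_)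
    rw [e]
    exact mul_ne_zero (mul_ne_zero hx hxp) hxq
  have hpos : 0 < x ∧ 0 < x + σ * q := by
    rcases hσ with rfl | rfl
    · have : 0 < x + ((1 : ℤ) : ℚ) * q := by
        rw [hq']
        push_cast at h₀ ⊢
        linarith
      exact ⟨by rwa [e, mul_pos_iff_of_pos_right this, mul_pos_iff_of_pos_right h₀] at hy, this⟩
    · have : 0 < x := by
        push_cast at h₀
        linarith
      exact ⟨this, by rwa [e, mul_pos_iff_of_pos_left (mul_pos this h₀)] at hy⟩
  obtain ⟨Q, hQ⟩ := exists_two_nsmul_eq (W := twinCurve p q σ) (e₁ := 0) (e₂ := -(σ * p))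
    (e₃ := -(σ * q)) rfl rfl (by simp [twinCurve]; ring) (by simp [twinCurve])
    (by simp [twinCurve]) (by simpa using ⟨hσ0, hp.1.ne_zero⟩)
    (by simpa using ⟨hσ0, hq.1.ne_zero⟩) (by simpa using ⟨hne, hσ0⟩) h
    (by simpa using Rat.isSquare_of_even_padicValRat hpos.1 fun ℓ hℓ ↦ (hev ℓ hℓ).1)
    (by simpa using Rat.isSquare_of_even_padicValRat h₀ fun ℓ hℓ ↦ (hev ℓ hℓ).2.1)
    (by simpa using Rat.isSquare_of_even_padicValRat hpos.2 fun ℓ hℓ ↦ (hev ℓ hℓ).2.2)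
  exact ⟨Q, hQ⟩

/-- A point with image `(1, 0, 0, 0)` would write both `p` and `q` as sums of two rational squares,
which is impossible since one of them is `3` modulo `4`. -/
theorem notMem_range_selmerHom (hp2 : p ≠ 2) (hpq : q = p + 2) (hne : p ≠ q)
    (hσ0 : (-1 : ℤ) ≠ 0) :
    (1, 0, 0, 0) ∉ (selmerHom (p := p) (q := q) (σ := -1) hne hσ0).range := by
  rintro ⟨_ | ⟨x, y, h⟩, hP⟩
  · have := congrArg Prod.fst
      ((map_zero (selmerHom (p := p) (q := q) (σ := -1) hne hσ0)).symm.trans hP)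
    exact zero_ne_one this
  rw [selmerHom_apply] at hP
  simp only [Prod.mk.injEq] at hP
  obtain ⟨h₀, h₁, h₂, h₃⟩ := hP
  obtain ⟨⟨hx, hxp, hxq⟩, hev⟩ := even_padicValRat hpq (.inr rfl) h h₁ h₂ h₃
  replace h₀ : ¬ signParity (descentMap (-(((-1 : ℤ) : ℚ) * p)) (some x y h)) = 0 := by
    rw [h₀]
    exact one_ne_zero
  rw [descentMap_some, if_neg (fun h0 ↦ hxp (by rw [h0]; ring)), sub_neg_eq_add,
    signParity_eq_zero_iff, not_le] at h₀
  have e := equation_iff.1 h.1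
  have hq' : (q : ℚ) = p + 2 := by rw [hpq]; push_cast; rfl
  have hy : 0 < y ^ 2 := by
    refine lt_of_le_of_ne (sq_nonneg y) (Ne.symm ?_)
    rw [e]
    exact mul_ne_zero (mul_ne_zero hx hxp) hxq
  have hxq' : x + ((-1 : ℤ) : ℚ) * q < 0 := by
    rw [hq']
    push_cast at h₀ ⊢
    linarith
  have hx0 : 0 < x := by
    rwa [e, mul_assoc, mul_pos_iff_of_pos_right (mul_pos_of_neg_of_neg h₀ hxq')] at hy
  obtain ⟨u, hu⟩ := Rat.isSquare_of_even_padicValRat hx0 fun ℓ hℓ ↦ (hev ℓ hℓ).1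
  obtain ⟨v, hv⟩ := Rat.isSquare_of_even_padicValRat (neg_pos.2 h₀) fun ℓ hℓ ↦ by
    rw [padicValRat.neg]
    exact (hev ℓ hℓ).2.1
  obtain ⟨w, hw⟩ := Rat.isSquare_of_even_padicValRat (neg_pos.2 hxq') fun ℓ hℓ ↦ by
    rw [padicValRat.neg]
    exact (hev ℓ hℓ).2.2
  push_cast at hv hw
  have hodd := hp.1.eq_two_or_odd.resolve_left hp2
  rcases (show p % 4 = 3 ∨ q % 4 = 3 by omega) with h4 | h4
  · exact hp.1.not_eq_sq_add_sq_rat h4 u v (by linear_combination hu + hv)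
  · exact hq.1.not_eq_sq_add_sq_rat h4 u w (by linear_combination hu + hw)

end

variable {p q : ℕ} {σ : ℤ} [hp : Fact p.Prime] [hq : Fact q.Prime]

theorem isElliptic (hne : p ≠ q) (hσ0 : σ ≠ 0) : (twinCurve p q σ).IsElliptic := by
  rw [WeierstrassCurve.isElliptic_iff]
  have : (twinCurve p q σ).Δ = 16 * (σ * p) ^ 2 * (σ * q) ^ 2 * (σ * (p - q)) ^ 2 := by
    simp only [twinCurve, WeierstrassCurve.Δ, WeierstrassCurve.b₂, WeierstrassCurve.b₄,
      WeierstrassCurve.b₆, WeierstrassCurve.b₈, Int.cast_natCast]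
    ring
  rw [this, isUnit_iff_ne_zero]
  simp [hσ0, hp.1.ne_zero, hq.1.ne_zero, sub_eq_zero, hne]

theorem index_range_two_nsmul (hpq : q = p + 2) (hσ : σ = 1 ∨ σ = -1) (hne : p ≠ q)
    (hσ0 : σ ≠ 0) :
    (nsmulAddMonoidHom (α := (twinCurve p q σ).toAffine.Point) 2).range.index ≠ 0 ∧
    (nsmulAddMonoidHom (α := (twinCurve p q σ).toAffine.Point) 2).range.index ∣
      Nat.card (selmerHom (σ := σ) hne hσ0).range := by
  have hdvd := AddSubgroup.index_dvd_of_le (ker_selmerHom_le hpq hσ hne hσ0)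
  rw [AddSubgroup.index_ker] at hdvd
  exact ⟨ne_zero_of_dvd_ne_zero Nat.card_pos.ne' hdvd, hdvd⟩

theorem fg (hpq : q = p + 2) (hσ : σ = 1 ∨ σ = -1) :
    AddGroup.FG (twinCurve p q σ).toAffine.Point := by
  have hne : p ≠ q := by omega
  have hσ0 : σ ≠ 0 := by rcases hσ with rfl | rfl <;> simp
  have := isElliptic hne hσ0
  exact fg_of_finiteIndex rfl rfl ⟨(index_range_two_nsmul hpq hσ hne hσ0).1⟩

theorem exists_two_torsion (hne : p ≠ q) (hσ0 : σ ≠ 0) :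
    ∃ t : Finset (twinCurve p q σ).toAffine.Point, t.card = 2 ^ 2 ∧ ∀ P ∈ t, 2 • P = 0 := by
  have := isElliptic hne hσ0
  have hns : ∀ x : ℚ, x * (x + σ * p) * (x + σ * q) = 0 →
      (twinCurve p q σ).toAffine.Nonsingular x 0 := fun x hx ↦
    equation_iff_nonsingular.1 (equation_iff.2 (by rw [hx]; simp))
  let T (x : ℚ) (hx : x * (x + σ * p) * (x + σ * q) = 0) : (twinCurve p q σ).toAffine.Point :=
    Point.some x 0 (hns x hx)
  have h2 : ∀ x hx, 2 • T x hx = 0 := by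
    intro x hx
    rw [two_nsmul, add_self_of_Y_eq]
    simp [negY, twinCurve]
  refine ⟨{0, T 0 (by simp), T (-(σ * p)) (by simp), T (-(σ * q)) (by simp)}, ?_, ?_⟩
  · rw [Finset.card_insert_of_notMem, Finset.card_insert_of_notMem,
      Finset.card_insert_of_notMem, Finset.card_singleton]
    all_goals simp [T, zero_def, hσ0, hne, hp.1.ne_zero, hq.1.ne_zero]
  · simp only [Finset.mem_insert, Finset.mem_singleton]
    rintro P (rfl | rfl | rfl | rfl)
    · exact nsmul_zero 2
    · exact h2 0 (by simp)
    · exact h2 (-(σ * p)) (by simp)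
    · exact h2 (-(σ * q)) (by simp)

theorem finrank_le_two (hpq : q = p + 2) (hσ : σ = 1 ∨ σ = -1) :
    Module.finrank ℤ (twinCurve p q σ).toAffine.Point ≤ 2 := by
  have hne : p ≠ q := by omega
  have hσ0 : σ ≠ 0 := by rcases hσ with rfl | rfl <;> simp
  have := fg hpq hσ
  obtain ⟨t, ht, ht'⟩ := exists_two_torsion (p := p) (q := q) hne hσ0
  obtain ⟨h0, hdvd⟩ := index_range_two_nsmul hpq hσ hne hσ0
  refine finrank_le_of_index_two_nsmul_le h0 ?_ ht ht'
  refine (Nat.le_of_dvd Nat.card_pos hdvd).trans ((AddSubgroup.card_le_card_addGroup _).trans ?_)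
  simp

theorem finrank_le_one (hp2 : p ≠ 2) (hpq : q = p + 2) :
    Module.finrank ℤ (twinCurve p q (-1)).toAffine.Point ≤ 1 := by
  have hne : p ≠ q := by omega
  have hσ0 : (-1 : ℤ) ≠ 0 := by simp
  have := fg (σ := -1) hpq (.inr rfl)
  obtain ⟨t, ht, ht'⟩ := exists_two_torsion (p := p) (q := q) hne hσ0
  obtain ⟨h0, hdvd⟩ := index_range_two_nsmul hpq (.inr rfl) hne hσ0
  refine finrank_le_of_index_two_nsmul_le h0 ?_ ht ht'
  refine (Nat.le_of_dvd Nat.card_pos hdvd).trans ?_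
  set H := (selmerHom (p := p) (q := q) (σ := -1) hne hσ0).range with hH
  have hindex : H.index ≠ 1 := by
    rw [Ne, AddSubgroup.index_eq_one]
    intro h
    exact notMem_range_selmerHom hp2 hpq hne hσ0 (hH ▸ h ▸ AddSubgroup.mem_top _)
  have hmul := H.card_mul_index
  have hcard : Nat.card (ZMod 2 × ZMod 2 × ZMod 2 × ZMod 2) = 16 := by simp
  rw [hcard] at hmul
  have : 2 ≤ H.index := by
    have : H.index ≠ 0 := by rintro h; simp [h] at hmul
    omega
  norm_num
  nlinarith

end twinCurve

namespace WeierstrassCurve.Affine.Point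

section

variable {K : Type*} [Field K] {W W' : WeierstrassCurve K}

theorem nonsingular_twist {i : K} (hi : i ^ 2 = -1) (h₁ : W.a₁ = 0) (h₃ : W.a₃ = 0)
    (h₁' : W'.a₁ = 0) (h₃' : W'.a₃ = 0) (h₂ : W'.a₂ = -W.a₂) (h₄ : W'.a₄ = W.a₄)
    (h₆ : W'.a₆ = -W.a₆) {x y : K} (h : W.toAffine.Nonsingular x y) :
    W'.toAffine.Nonsingular (-x) (i * y) := by
  have hi0 : i ≠ 0 := by rintro rfl; simp at hi
  rw [nonsingular_iff', WeierstrassCurve.Affine.equation_iff] at h ⊢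
  simp only [h₁, h₃, h₁', h₃', h₂, h₄, h₆, zero_mul, add_zero] at h ⊢
  obtain ⟨he, hn⟩ := h
  refine ⟨by rw [mul_pow, hi, he]; ring, hn.imp (fun hn h0 ↦ hn ?_) (fun hn h0 ↦ hn ?_)⟩
  · linear_combination h0
  · exact (mul_eq_zero.1 (show i * (2 * y) = 0 by linear_combination h0)).resolve_left hi0

/-- The isomorphism `(x, y) ↦ (-x, i * y)` from `y² = x³ + a₂x² + a₄x + a₆` to its twist
by `i² = -1`, on points. -/
def twist [DecidableEq K] {i : K} (hi : i ^ 2 = -1) (h₁ : W.a₁ = 0) (h₃ : W.a₃ = 0)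
    (h₁' : W'.a₁ = 0) (h₃' : W'.a₃ = 0) (h₂ : W'.a₂ = -W.a₂) (h₄ : W'.a₄ = W.a₄)
    (h₆ : W'.a₆ = -W.a₆) : W.toAffine.Point →+ W'.toAffine.Point where
  toFun P := match P with
    | zero => 0
    | some x y h => some (-x) (i * y) (nonsingular_twist hi h₁ h₃ h₁' h₃' h₂ h₄ h₆ h)
  map_zero' := rfl
  map_add' := by
    have hi0 : i ≠ 0 := by rintro rfl; simp at hi
    have neg_eq : ∀ x y : K, W'.toAffine.negY (-x) (i * y) = i * W.toAffine.negY x y := by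
      intro x y
      simp [negY, h₁, h₃, h₁', h₃']
    rintro (_ | ⟨x₁, y₁, hP⟩) (_ | ⟨x₂, y₂, hQ⟩)
    · rfl
    · rfl
    · rfl
    · by_cases hxy : x₁ = x₂ ∧ y₁ = W.toAffine.negY x₂ y₂
      · rw [add_of_Y_eq hxy.1 hxy.2]
        simp only
        rw [add_of_Y_eq (by rw [hxy.1]) (by rw [neg_eq, ← hxy.2])]
      · have hxy' : ¬ (-x₁ = -x₂ ∧ i * y₁ = W'.toAffine.negY (-x₂) (i * y₂)) := by
          rwa [neg_eq, neg_inj, mul_right_inj' hi0]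
        have hsl : W'.toAffine.slope (-x₁) (-x₂) (i * y₁) (i * y₂) =
            -i * W.toAffine.slope x₁ x₂ y₁ y₂ := by
          by_cases hx : x₁ = x₂
          · have hy : y₁ ≠ W.toAffine.negY x₂ y₂ := fun h ↦ hxy ⟨hx, h⟩
            obtain rfl := Y_eq_of_Y_ne hP.1 hQ.1 hx hy
            subst hx
            rw [slope_of_Y_ne rfl hy, slope_of_Y_ne rfl (by rwa [neg_eq, Ne, mul_right_inj' hi0]),
              neg_eq, ← mul_sub, h₁, h₁', h₂, h₄]
            have := sub_ne_zero.2 hy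
            field_simp
            linear_combination (3 * x₁ ^ 2 + 2 * x₁ * W.a₂ + W.a₄) * hi
          · rw [slope_of_X_ne hx, slope_of_X_ne (by simpa using hx)]
            have := sub_ne_zero.2 hx
            have h' : -x₁ - -x₂ ≠ 0 := sub_ne_zero.2 (by simpa using hx)
            rw [← mul_sub, div_eq_iff h']
            field_simp
            ring
        rw [add_some hxy]
        simp only
        rw [add_some hxy', some.injEq]
        simp only [hsl, addX, addY, negAddY, negY, h₁, h₃, h₁', h₃', h₂]
        constructor
        · linear_combination (-(W.toAffine.slope x₁ x₂ y₁ y₂) ^ 2) * hi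
        · linear_combination (-i * (W.toAffine.slope x₁ x₂ y₁ y₂) ^ 3) * hi

theorem twist_some [DecidableEq K] {i : K} (hi : i ^ 2 = -1) (h₁ : W.a₁ = 0) (h₃ : W.a₃ = 0)
    (h₁' : W'.a₁ = 0) (h₃' : W'.a₃ = 0) (h₂ : W'.a₂ = -W.a₂) (h₄ : W'.a₄ = W.a₄)
    (h₆ : W'.a₆ = -W.a₆) {x y : K} (h : W.toAffine.Nonsingular x y) :
    twist hi h₁ h₃ h₁' h₃' h₂ h₄ h₆ (some x y h) =
      some (-x) (i * y) (nonsingular_twist hi h₁ h₃ h₁' h₃' h₂ h₄ h₆ h) :=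
  rfl

theorem twist_injective [DecidableEq K] {i : K} (hi : i ^ 2 = -1) (h₁ : W.a₁ = 0) (h₃ : W.a₃ = 0)
    (h₁' : W'.a₁ = 0) (h₃' : W'.a₃ = 0) (h₂ : W'.a₂ = -W.a₂) (h₄ : W'.a₄ = W.a₄)
    (h₆ : W'.a₆ = -W.a₆) : Function.Injective (twist hi h₁ h₃ h₁' h₃' h₂ h₄ h₆) := by
  rw [injective_iff_map_eq_zero]
  rintro (_ | ⟨x, y, h⟩) hP
  · rfl
  · exact absurd hP (some_ne_zero _)

end

section

variable {F K : Type*} [Field F] [Field K] [Algebra F K] [DecidableEq F] [DecidableEq K]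
  {W W' : WeierstrassCurve F}

theorem mem_range_baseChange {c : K →ₐ[F] K} (hfix : ∀ z, c z = z → z ∈ (algebraMap F K).range)
    {P : (W⁄K).Point} (hP : map c P = P) : P ∈ (baseChange (W' := W) F K).range := by
  rcases P with _ | ⟨x, y, h⟩
  · exact zero_mem _
  rw [map_some, some.injEq] at hP
  obtain ⟨a, rfl⟩ := hfix x hP.1
  obtain ⟨b, rfl⟩ := hfix y hP.2
  exact ⟨some a b ((baseChange_nonsingular W (f := Algebra.ofId F K)
    (algebraMap F K).injective a b).1 h), rfl⟩

omit [DecidableEq F] in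
theorem map_twist {c : K →ₐ[F] K} {i : K} (hi : i ^ 2 = -1) (hc : c i = -i) (h₁ : (W⁄K).a₁ = 0)
    (h₃ : (W⁄K).a₃ = 0) (h₁' : (W'⁄K).a₁ = 0) (h₃' : (W'⁄K).a₃ = 0)
    (h₂ : (W'⁄K).a₂ = -(W⁄K).a₂) (h₄ : (W'⁄K).a₄ = (W⁄K).a₄) (h₆ : (W'⁄K).a₆ = -(W⁄K).a₆)
    (P : (W⁄K).Point) :
    map c (twist hi h₁ h₃ h₁' h₃' h₂ h₄ h₆ P) =
      -twist hi h₁ h₃ h₁' h₃' h₂ h₄ h₆ (map c P) := by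
  rcases P with _ | ⟨x, y, h⟩
  · rfl
  · rw [map_some, twist_some, twist_some, map_some, neg_some, some.injEq]
    simp only [negY, h₁', h₃', map_mul, hc]
    simp

theorem exists_baseChange_comp_eq {A : Type*} [AddCommGroup A] {c : K →ₐ[F] K}
    (hfix : ∀ z, c z = z → z ∈ (algebraMap F K).range) (g : A →+ (W⁄K).Point)
    (hg : ∀ a, map c (g a) = g a) :
    ∃ g' : A →+ (W⁄F).Point, (baseChange (W' := W) F K).comp g' = g := by
  have hj : Function.Injective (baseChange (W' := W) F K) := map_injective _
  refine ⟨(AddMonoidHom.ofInjective hj).symm.toAddMonoidHom.comp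
    (g.codRestrict _ fun a ↦ mem_range_baseChange hfix (hg a)), ?_⟩
  ext a
  exact congrArg Subtype.val
    ((AddMonoidHom.ofInjective hj).apply_symm_apply ⟨g a, mem_range_baseChange hfix (hg a)⟩)

/-- The rank of `W` over `K = F(i)` is at most the sum of the ranks over `F` of `W` and of its
quadratic twist by `-1`. -/
theorem le_finrank_add_finrank_of_injective {c : K →ₐ[F] K} {i : K} (hi : i ^ 2 = -1)
    (hc : c i = -i) (hcc : ∀ z, c (c z) = z)
    (hfix : ∀ z, c z = z → z ∈ (algebraMap F K).range)
    (h₁ : W.a₁ = 0) (h₃ : W.a₃ = 0) (h₁' : W'.a₁ = 0) (h₃' : W'.a₃ = 0)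
    (h₂ : W'.a₂ = -W.a₂) (h₄ : W'.a₄ = W.a₄) (h₆ : W'.a₆ = -W.a₆)
    [AddGroup.FG (W⁄F).Point] [AddGroup.FG (W'⁄F).Point] {n : ℕ}
    {f : (Fin n → ℤ) →+ (W⁄K).Point} (hf : Function.Injective f) :
    n ≤ Module.finrank ℤ (W⁄F).Point + Module.finrank ℤ (W'⁄F).Point := by
  have hmm (P : (W⁄K).Point) : map c (map c P) = P := by
    rcases P with _ | ⟨x, y, h⟩
    · rfl
    · simp [map_some, hcc]
  have k₁ : (W⁄K).a₁ = 0 := by simp [h₁]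
  have k₃ : (W⁄K).a₃ = 0 := by simp [h₃]
  have k₁' : (W'⁄K).a₁ = 0 := by simp [h₁']
  have k₃' : (W'⁄K).a₃ = 0 := by simp [h₃']
  have k₂ : (W'⁄K).a₂ = -(W⁄K).a₂ := by simp [h₂]
  have k₄ : (W'⁄K).a₄ = (W⁄K).a₄ := by simp [h₄]
  have k₆ : (W'⁄K).a₆ = -(W⁄K).a₆ := by simp [h₆]
  let φ := twist hi k₁ k₃ k₁' k₃' k₂ k₄ k₆
  have hφ : Function.Injective φ := twist_injective hi k₁ k₃ k₁' k₃' k₂ k₄ k₆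
  have hφc (P) : map c (φ P) = -φ (map c P) := map_twist hi hc k₁ k₃ k₁' k₃' k₂ k₄ k₆ P
  obtain ⟨g₁, hg₁⟩ := exists_baseChange_comp_eq hfix (f + (map c).comp f) fun a ↦ by
    simp [hmm, add_comm]
  obtain ⟨g₂, hg₂⟩ := exists_baseChange_comp_eq hfix (φ.comp (f - (map c).comp f)) fun a ↦ by
    simp [hφc, hmm, add_comm, sub_eq_add_neg]
  have hker (a) (ha₁ : g₁ a = 0) (ha₂ : g₂ a = 0) : a = 0 := by
    have e₁ := DFunLike.congr_fun hg₁ a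
    have e₂ := DFunLike.congr_fun hg₂ a
    rw [AddMonoidHom.comp_apply, ha₁, _root_.map_zero] at e₁
    rw [AddMonoidHom.comp_apply, ha₂, _root_.map_zero, AddMonoidHom.comp_apply, eq_comm,
      map_eq_zero_iff φ hφ] at e₂
    have : f (2 • a) = 0 := by
      rw [map_nsmul, two_nsmul]
      simp only [AddMonoidHom.add_apply, AddMonoidHom.sub_apply] at e₁ e₂
      rw [sub_eq_zero] at e₂
      nth_rw 2 [e₂]
      exact e₁.symm
    rw [map_eq_zero_iff f hf] at this
    exact (smul_eq_zero.1 this).resolve_left two_ne_zero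
  have : Module.Finite ℤ (W⁄F).Point := Module.Finite.iff_addGroup_fg.2 inferInstance
  have : Module.Finite ℤ (W'⁄F).Point := Module.Finite.iff_addGroup_fg.2 inferInstance
  have hr := Submodule.finrank_quotient_add_finrank (LinearMap.ker g₁.toIntLinearMap)
  rw [g₁.toIntLinearMap.quotKerEquivRange.finrank_eq, Module.finrank_fin_fun] at hr
  rw [← hr]
  refine add_le_add (Submodule.finrank_le _) ?_
  refine LinearMap.finrank_le_finrank_of_injective
    (f := g₂.toIntLinearMap.domRestrict (LinearMap.ker g₁.toIntLinearMap)) ?_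
  rw [injective_iff_map_eq_zero]
  rintro ⟨a, ha⟩ ha'
  exact Subtype.ext (hker a ha ha')

end

end WeierstrassCurve.Affine.Point

namespace GaussField

theorem I_mem : Complex.I ∈ GaussField :=
  IntermediateField.mem_adjoin_simple_self ℚ _

theorem exists_eq_add_mul_I_s2 {z : ℂ} (hz : z ∈ GaussField) :
    ∃ a b : ℚ, z = a + b * Complex.I := by
  induction hz using IntermediateField.adjoin_induction with
  | mem x hx => exact ⟨0, 1, by simpa using hx⟩
  | algebraMap x => exact ⟨x, 0, by simp⟩
  | add x y _ _ hx hy =>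
    obtain ⟨a, b, rfl⟩ := hx
    obtain ⟨c, d, rfl⟩ := hy
    exact ⟨a + c, b + d, by push_cast; ring⟩
  | inv x _ hx =>
    obtain ⟨a, b, rfl⟩ := hx
    refine ⟨a / (a ^ 2 + b ^ 2), -b / (a ^ 2 + b ^ 2), ?_⟩
    rw [Complex.inv_def]
    apply Complex.ext <;> simp [Complex.normSq_apply, ← sq, div_eq_mul_inv]
  | mul x y _ _ hx hy =>
    obtain ⟨a, b, rfl⟩ := hx
    obtain ⟨c, d, rfl⟩ := hy
    exact ⟨a * c - b * d, a * d + b * c, by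
      push_cast
      linear_combination (b * d : ℂ) * Complex.I_sq⟩

open ComplexConjugate in
theorem conj_mem {z : ℂ} (hz : z ∈ GaussField) : conj z ∈ GaussField := by
  obtain ⟨a, b, rfl⟩ := exists_eq_add_mul_I_s2 hz
  rw [map_add, map_mul, Complex.conj_I, map_ratCast, map_ratCast]
  exact add_mem (SubfieldClass.ratCast_mem GaussField a)
    (mul_mem (SubfieldClass.ratCast_mem GaussField b) (neg_mem I_mem))

/-- Complex conjugation on the Gauss field. -/
noncomputable def conjAlgHom : GaussField →ₐ[ℚ] GaussField :=
  ((Complex.conjAe.toAlgHom.restrictScalars ℚ).comp GaussField.val).codRestrict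
    GaussField.toSubalgebra fun z ↦ conj_mem z.2

open ComplexConjugate in
@[simp]
theorem coe_conjAlgHom (z : GaussField) : (conjAlgHom z : ℂ) = conj (z : ℂ) := rfl

theorem mem_range_of_conjAlgHom_eq {z : GaussField} (hz : conjAlgHom z = z) :
    z ∈ (algebraMap ℚ GaussField).range := by
  obtain ⟨a, b, hab⟩ := exists_eq_add_mul_I_s2 z.2
  have him := Complex.conj_eq_iff_im.1 (congrArg Subtype.val hz)
  have hb : b = 0 := by simpa [hab] using him
  exact ⟨a, Subtype.ext (by rw [hab, hb]; simp)⟩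

end GaussField

namespace twinCurve

open WeierstrassCurve.Affine WeierstrassCurve.Affine.Point

theorem baseChange_self (W : WeierstrassCurve.Affine ℚ) : W⁄ℚ = W :=
  WeierstrassCurve.map_id W

theorem not_injective_of_prime {p q : ℕ} [Fact p.Prime] [Fact q.Prime] (hp2 : p ≠ 2)
    (hpq : q = p + 2) {σ : ℤ} (hσ : σ = 1 ∨ σ = -1)
    (f : (Fin 4 → ℤ) →+ ((twinCurve p q σ).baseChange GaussField).toAffine.Point) :
    ¬ Function.Injective f := by
  intro hf
  have : AddGroup.FG ((twinCurve p q σ)⁄ℚ).Point := by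
    rw [baseChange_self]
    exact fg hpq hσ
  have : AddGroup.FG ((twinCurve p q (-σ))⁄ℚ).Point := by
    rw [baseChange_self]
    exact fg hpq (by omega)
  have hle := le_finrank_add_finrank_of_injective (W := twinCurve p q σ)
    (W' := twinCurve p q (-σ)) (F := ℚ) (c := GaussField.conjAlgHom)
    (i := ⟨Complex.I, GaussField.I_mem⟩) (Subtype.ext (by simp)) (Subtype.ext (by simp))
    (fun z ↦ Subtype.ext (by simp)) (fun z ↦ GaussField.mem_range_of_conjAlgHom_eq)
    rfl rfl rfl rfl (by simp [twinCurve]) (by simp [twinCurve]) (by simp [twinCurve]) hf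
  rw [baseChange_self, baseChange_self] at hle
  have h₁ : Module.finrank ℤ (Point (twinCurve p q (-1))) ≤ 1 := finrank_le_one hp2 hpq
  have h₂ : Module.finrank ℤ (Point (twinCurve p q 1)) ≤ 2 := finrank_le_two hpq (.inl rfl)
  rcases hσ with rfl | rfl
  · omega
  · rw [neg_neg] at hle
    omega

theorem neg_swap (p q σ : ℤ) : twinCurve (-q) (-p) (-σ) = twinCurve p q σ := by
  simp [twinCurve]
  ring_nf
  simp

end twinCurve

/-- Rank of `E_σ(ℚ(i))` is at most 3: `ℤ⁴` does not embed into the Mordell–Weil group. -/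
theorem stmt_2 (p q : ℤ) (hp : Prime p) (hq : Prime q) (htwin : q - p = 2)
    (σ : ℤ) (hσ : σ = 1 ∨ σ = -1)
    (f : (Fin 4 → ℤ) →+ (((twinCurve p q σ).baseChange GaussField).toAffine.Point)) :
    ¬ Function.Injective f := by
  wlog hp0 : 0 < p generalizing p q σ
  · have hq0 : q < 0 := by
      by_contra hq0
      have h1 := hp.ne_zero
      have h2 := hq.ne_zero
      obtain rfl : p = -1 := by omega
      exact hp.not_isUnit (by simp)
    have key := this (-q) (-p) hq.neg hp.neg (by omega) (-σ) (by omega)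
    rw [twinCurve.neg_swap] at key
    exact key f (by omega)
  lift p to ℕ using hp0.le
  lift q to ℕ using by omega
  have := Fact.mk (Nat.prime_iff_prime_int.2 hp)
  have hq' := Nat.prime_iff_prime_int.2 hq
  have := Fact.mk hq'
  have hpq : q = p + 2 := by omega
  refine twinCurve.not_injective_of_prime ?_ hpq hσ f
  rintro rfl
  rw [hpq] at hq'
  revert hq'
  decide
end
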